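/- arXiv:2111.02903 — 13 statements merged into one kernel-verified Lean document; each statement's English description precedes it below -/
import Mathlib

section
/- Let X be a finite set and R a reflexive and symmetric relation on X. Let L be the real X×X matrix with L x y = 1 if (x,y) ∈ R and L x y = 0 otherwise. Then L is positive semidefinite if and only if for all i, j, k ∈ X one has L i j + L j k - L i k ≤ 1. -/
/-- The real 0-1 matrix of an equivalence relation is positive semidefinite: it is the Gram matrix
of the indicator vectors of the equivalence classes. -/
theorem posSemidef_of_equivalence {X : Type*} [Fintype X] (R : X → X → Prop) [DecidableRel R]
    (hR : Equivalence R) :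
    (Matrix.of fun x y => if R x y then (1 : ℝ) else 0).PosSemidef := by
  classical
  let s : Setoid X := ⟨R, hR⟩
  let A : Matrix (Quotient s) X ℝ := Matrix.of fun q x => if Quotient.mk s x = q then 1 else 0
  have hA : (Matrix.of fun x y => if R x y then (1 : ℝ) else 0) = A.conjTranspose * A := by
    ext x y
    have hxy : Quotient.mk s x = Quotient.mk s y ↔ R x y := Quotient.eq
    rw [Matrix.mul_apply, Finset.sum_eq_single (Quotient.mk s y)]
    · simp only [A, Matrix.conjTranspose_apply, Matrix.of_apply, hxy]
      simp
    · intro q _ hq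
      simp [A, hq.symm]
    · simp
  rw [hA]
  exact Matrix.posSemidef_conjTranspose_mul_self A

/-- Testing a positive semidefinite real matrix against `e i - e j + e k`. -/
theorem Matrix.PosSemidef.two_mul_add_sub_le {X : Type*} [Fintype X] {L : Matrix X X ℝ}
    (hL : L.PosSemidef) (i j k : X) :
    2 * (L i j + L j k - L i k) ≤ L i i + L j j + L k k := by
  have h := (hL.submatrix ![i, j, k]).dotProduct_mulVec_nonneg ![1, -1, 1]
  have hs : ∀ x y, L y x = L x y := fun x y => by simpa using hL.isHermitian.apply x y
  simp [dotProduct, Matrix.mulVec, Fin.sum_univ_three] at h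
  linarith [hs i j, hs j k, hs i k]

/-- For a reflexive symmetric relation `R` on a finite set `X`, the 0-1 matrix
`L` of `R` is positive semidefinite iff its entries satisfy the triangle inequalities
`L i j + L j k - L i k ≤ 1`. -/
theorem stmt0 {X : Type*} [Fintype X] (R : X → X → Prop) [DecidableRel R]
    (hrefl : ∀ x, R x x) (hsymm : ∀ x y, R x y → R y x)
    (L : Matrix X X ℝ) (hL : ∀ x y, L x y = if R x y then 1 else 0) :
    L.PosSemidef ↔ ∀ i j k, L i j + L j k - L i k ≤ 1 := by
  constructor
  · intro h i j k
    have h3 := h.two_mul_add_sub_le i j k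
    simp only [hL, hrefl, if_true] at h3 ⊢
    split_ifs at h3 ⊢ <;> linarith
  · intro h
    have htrans : ∀ {x y z}, R x y → R y z → R x z := by
      intro x y z hxy hyz
      by_contra hxz
      have := h x y z
      norm_num [hL, hxy, hyz, hxz] at this
    have hL' : L = Matrix.of fun x y => if R x y then (1 : ℝ) else 0 := by
      ext x y
      exact hL x y
    rw [hL']
    exact posSemidef_of_equivalence R ⟨hrefl, fun {x y} => hsymm x y, htrans⟩
end

section
/- Let X be a finite set and R a reflexive and symmetric relation on X. Let L be the real X×X matrix with L x y = 1 if (x,y) ∈ R and L x y = 0 otherwise. Then L is positive semidefinite if and only if R is transitive (i.e., R is an equivalence relation). -/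
/-- For a reflexive symmetric relation `R` on a finite set `X`, the 0-1 matrix
`L` of `R` is positive semidefinite iff `R` is transitive (i.e. an equivalence relation). -/
theorem stmt1 {X : Type*} [Fintype X] (R : X → X → Prop) [DecidableRel R]
    (hrefl : ∀ x, R x x) (hsymm : ∀ x y, R x y → R y x)
    (L : Matrix X X ℝ) (hL : ∀ x y, L x y = if R x y then 1 else 0) :
    L.PosSemidef ↔ ∀ x y z, R x y → R y z → R x z := by
  constructor
  · intro h x y z hxy hyz
    by_contra hxz
    have hzx : ¬ R z x := fun hzx => hxz (hsymm z x hzx)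
    have key := (h.submatrix ![x, y, z]).dotProduct_mulVec_nonneg ![1, -1, 1]
    simp [Matrix.mulVec, dotProduct, Fin.sum_univ_three, hL, hrefl, hxy, hyz, hxz, hzx,
      hsymm x y hxy, hsymm y z hyz] at key
    norm_num at key
  · intro htrans
    classical
    let s : Setoid X := ⟨R, hrefl, @fun x y => hsymm x y, @fun x y z => htrans x y z⟩
    have hLs : L = (1 : Matrix (Quotient s) (Quotient s) ℝ).submatrix
        (Quotient.mk s) (Quotient.mk s) := by
      ext x y
      rw [hL, Matrix.submatrix_apply, Matrix.one_apply]
      exact if_congr (Quotient.eq (r := s)).symm rfl rfl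
    rw [hLs]
    exact Matrix.PosSemidef.one.submatrix _
end

section
/- Let X be a finite set and R a reflexive and symmetric relation on X such that R generates the full equivalence relation on X (i.e., for all x, y ∈ X there is a finite chain x = x₀, x₁, …, x_d = y with (x_{i}, x_{i+1}) ∈ R for all i). Then the subalgebra of the X×X complex matrices generated by E(R) is the whole matrix algebra: Algebra.adjoin ℂ E(R) = ⊤. -/
/-- The matrix unit at a related pair is supported on the relation. -/
lemma single_mem_adjoin_of_rel {X : Type*} [Fintype X] [DecidableEq X] {R : X → X → Prop}
    {x y : X} (h : R x y) (c : ℂ) :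
    Matrix.single x y c ∈
      Algebra.adjoin ℂ {B : Matrix X X ℂ | ∀ x y, ¬ R x y → B x y = 0} := by
  refine Algebra.subset_adjoin fun a b hab => Matrix.single_apply_of_ne _ _ _ _ _ ?_
  rintro ⟨rfl, rfl⟩
  exact hab h

/-- Matrix units along an `R`-chain multiply to the matrix unit at its endpoints. -/
lemma single_mem_adjoin_of_reflTransGen {X : Type*} [Fintype X] [DecidableEq X]
    {R : X → X → Prop} (hrefl : ∀ x, R x x) {x y : X} (h : Relation.ReflTransGen R x y) (c : ℂ) :
    Matrix.single x y c ∈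
      Algebra.adjoin ℂ {B : Matrix X X ℂ | ∀ x y, ¬ R x y → B x y = 0} := by
  induction h with
  | refl => exact single_mem_adjoin_of_rel (hrefl x) c
  | tail _ hbc ih =>
    simpa using mul_mem ih (single_mem_adjoin_of_rel hbc 1)

/-- If the reflexive symmetric relation `R` on the finite set `X` generates the
full equivalence relation (any two points are joined by a finite `R`-chain), then the
subalgebra of the complex `X × X` matrices generated by `E(R)` is everything. -/
theorem stmt3 {X : Type*} [Fintype X] [DecidableEq X] (R : X → X → Prop)
    (hrefl : ∀ x, R x x) (hsymm : ∀ x y, R x y → R y x)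
    (hconn : ∀ x y : X, Relation.ReflTransGen R x y) :
    Algebra.adjoin ℂ {B : Matrix X X ℂ | ∀ x y, ¬ R x y → B x y = 0} = ⊤ := by
  refine eq_top_iff.2 fun B _ => ?_
  rw [Matrix.matrix_eq_sum_single B]
  exact sum_mem fun x _ => sum_mem fun y _ =>
    single_mem_adjoin_of_reflTransGen hrefl (hconn x y) _
end

section
/- Let X be a finite set, R a reflexive and symmetric relation on X, and v ∈ ℂ^X a unit vector with support S := { x ∈ X : v x ≠ 0 }. The vector state φ_v restricted to E(R), given by φ_v(B) = Σ_{x,y} conj(v x) · B x y · v y, is a pure state on E(R) (an extreme point of the convex set of states on E(R)) if and only if the restriction of R to S generates the full equivalence relation on S; that is, for all x, y ∈ S, the pair (x,y) lies in the equivalence relation generated by the relation { (a,b) ∈ R : a ∈ S and b ∈ S }. -/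
open scoped ComplexOrder

open Matrix

/-- A complex quadratic form without constant term that is nonnegative everywhere has no linear
part. -/
theorem eq_zero_of_quadratic_nonneg {α β γ : ℂ}
    (h : ∀ z : ℂ, 0 ≤ star z * α + z * β + z * star z * γ) : α = 0 ∧ β = 0 := by
  have key : ∀ a c : ℂ, (∀ t : ℝ, 0 ≤ (t : ℂ) * a + (t : ℂ) ^ 2 * c) → a = 0 := by
    intro a c hac
    have hre : ∀ t : ℝ, 0 ≤ t * a.re + t ^ 2 * c.re := fun t => by
      have := (Complex.le_def.1 (hac t)).1
      simpa [← Complex.ofReal_pow] using this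
    have him : ∀ t : ℝ, 0 = t * a.im + t ^ 2 * c.im := fun t => by
      have := (Complex.le_def.1 (hac t)).2
      simpa [← Complex.ofReal_pow] using this
    apply Complex.ext
    · have hd : discrim c.re a.re 0 ≤ 0 := discrim_le_zero fun t => by
        have := hre t
        nlinarith
      simp only [discrim] at hd
      have : a.re ^ 2 = 0 := le_antisymm (by linarith) (sq_nonneg _)
      simpa using this
    · have h1 := him 1
      have h2 := him (-1)
      simp only [Complex.zero_im]
      linarith
  have hadd : α + β = 0 := key _ γ fun t => by
    have := h t
    simp only [Complex.star_def, Complex.conj_ofReal] at this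
    convert this using 1
    ring
  have hsub : Complex.I * (β - α) = 0 := key _ γ fun t => by
    have := h (t * Complex.I)
    simp only [Complex.star_def, map_mul, Complex.conj_ofReal, Complex.conj_I] at this
    convert this using 1
    linear_combination (t : ℂ) ^ 2 * γ * Complex.I_sq
  have hβ : β - α = 0 := by simpa using hsub
  constructor
  · linear_combination (hadd - hβ) / 2
  · linear_combination (hadd + hβ) / 2

/-- A functional that is nonnegative on the positive semidefinite elements of `E` satisfies the
degenerate Cauchy–Schwarz inequality on rank-one matrices. -/
theorem apply_vecMulVec_eq_zero {X : Type*} [Fintype X] {E : Submodule ℂ (Matrix X X ℂ)}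
    {Ψ : Matrix X X ℂ →ₗ[ℂ] ℂ} (hpos : ∀ B ∈ E, B.PosSemidef → 0 ≤ Ψ B) {w u : X → ℂ}
    (hmem : ∀ z : ℂ, vecMulVec (w + z • u) (star (w + z • u)) ∈ E)
    (hw : Ψ (vecMulVec w (star w)) = 0) :
    Ψ (vecMulVec w (star u)) = 0 ∧ Ψ (vecMulVec u (star w)) = 0 := by
  refine eq_zero_of_quadratic_nonneg (γ := Ψ (vecMulVec u (star u))) fun z => ?_
  have h := hpos _ (hmem z) (posSemidef_vecMulVec_self_star _)
  simp only [star_add, star_smul, vecMulVec_add, add_vecMulVec, vecMulVec_smul, smul_vecMulVec,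
    map_add, map_smul, hw, smul_eq_mul] at h
  convert h using 1
  ring

/-- The functional `B ↦ ⟨w, B w⟩` on matrices. -/
noncomputable def vectorFunctional {X : Type*} [Fintype X] (w : X → ℂ) :
    Matrix X X ℂ →ₗ[ℂ] ℂ where
  toFun B := star w ⬝ᵥ (B *ᵥ w)
  map_add' A B := by rw [add_mulVec, dotProduct_add]
  map_smul' c B := by simp [smul_mulVec, dotProduct_smul]

theorem vectorFunctional_apply {X : Type*} [Fintype X] (w : X → ℂ) (B : Matrix X X ℂ) :
    vectorFunctional w B = ∑ x, ∑ y, starRingEnd ℂ (w x) * B x y * w y := by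
  simp [vectorFunctional, dotProduct, mulVec, Finset.mul_sum, mul_assoc]

theorem vectorFunctional_nonneg {X : Type*} [Fintype X] (w : X → ℂ) {B : Matrix X X ℂ}
    (hB : B.PosSemidef) : 0 ≤ vectorFunctional w B :=
  hB.dotProduct_mulVec_nonneg w

theorem vectorFunctional_one {X : Type*} [Fintype X] [DecidableEq X] (w : X → ℂ) :
    vectorFunctional w 1 = ((∑ x, ‖w x‖ ^ 2 : ℝ) : ℂ) := by
  simp [vectorFunctional, dotProduct, Complex.conj_mul']

theorem vectorFunctional_single {X : Type*} [Fintype X] [DecidableEq X] (w : X → ℂ) (x y : X) :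
    vectorFunctional w (Matrix.single x y 1) = star (w x) * w y := by
  simp [vectorFunctional, Matrix.single_mulVec, Function.update_apply, dotProduct]

theorem vectorFunctional_vecMulVec {X : Type*} [Fintype X] {v w : X → ℂ}
    (h : star w ⬝ᵥ v = 0) : vectorFunctional v (vecMulVec w (star w)) = 0 := by
  simp [vectorFunctional, vecMulVec_mulVec, h]

/-- A state killing every rank-one positive element of `E` orthogonal to `v` agrees on `E` with
the vector functional of `v`, provided the support of `v` is connected. -/
theorem eq_vectorFunctional_of_connected {X : Type*} [Fintype X] [DecidableEq X]
    {R : X → X → Prop} (hrefl : ∀ x, R x x) (hsymm : ∀ x y, R x y → R y x)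
    {E : Submodule ℂ (Matrix X X ℂ)}
    (hE : ∀ B : Matrix X X ℂ, B ∈ E ↔ ∀ x y, ¬ R x y → B x y = 0)
    {v : X → ℂ} (hv : ∑ x, ‖v x‖ ^ 2 = 1)
    (hconn : ∀ x, v x ≠ 0 → ∀ y, v y ≠ 0 →
      Relation.EqvGen (fun a b => v a ≠ 0 ∧ v b ≠ 0 ∧ R a b) x y)
    {Ψ : Matrix X X ℂ →ₗ[ℂ] ℂ} (hpos : ∀ B ∈ E, B.PosSemidef → 0 ≤ Ψ B) (hΨ : Ψ 1 = 1)
    (hker : ∀ w : X → ℂ, vecMulVec w (star w) ∈ E → star w ⬝ᵥ v = 0 →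
      Ψ (vecMulVec w (star w)) = 0) {B : Matrix X X ℂ} (hB : B ∈ E) :
    Ψ B = vectorFunctional v B := by
  set p : X → X → ℂ := fun x y => Ψ (Matrix.single x y 1) with hp
  have hmem : ∀ x y, R x y → ∀ a b : ℂ,
      vecMulVec (Pi.single x a + Pi.single y b) (star (Pi.single x a + Pi.single y b)) ∈ E := by
    intro x y hxy a b
    refine (hE _).2 fun s t hst => ?_
    have hs : s = x ∨ s = y ∨ (s ≠ x ∧ s ≠ y) := by tauto
    have ht : t = x ∨ t = y ∨ (t ≠ x ∧ t ≠ y) := by tauto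
    rcases hs with rfl | rfl | hs
    · rcases ht with rfl | rfl | ht
      · exact absurd (hrefl _) hst
      · exact absurd hxy hst
      · simp [vecMulVec_apply, ht.1, ht.2]
    · rcases ht with rfl | rfl | ht
      · exact absurd (hsymm _ _ hxy) hst
      · exact absurd (hrefl _) hst
      · simp [vecMulVec_apply, ht.1, ht.2]
    · simp [vecMulVec_apply, hs.1, hs.2]
  have hsingle : ∀ (x y : X) (a b : ℂ),
      Ψ (vecMulVec (Pi.single x a) (Pi.single y b)) = a * b * p x y := by
    intro x y a b
    have : vecMulVec (Pi.single x a) (Pi.single y b) = (a * b) • Matrix.single x y (1 : ℂ) := by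
      rw [Matrix.single_eq_single_vecMulVec_single]
      ext s t
      simp only [vecMulVec_apply, Matrix.smul_apply, smul_eq_mul, Pi.single_apply]
      split_ifs <;> simp
    rw [this, map_smul, smul_eq_mul]
  have hedge : ∀ x y, R x y → ∀ a b : ℂ, star a * v x + star b * v y = 0 →
      a * p x y + b * p y y = 0 ∧ star a * p x x + star b * p x y = 0 := by
    intro x y hxy a b hab
    have horth : star (Pi.single x a + Pi.single y b) ⬝ᵥ v = 0 := by
      simpa [star_add, add_dotProduct, ← Pi.single_star] using hab
    have h0 := hker _ (hmem x y hxy a b) horth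
    have hy := (apply_vecMulVec_eq_zero (u := Pi.single y 1) hpos (fun z => by
      have : Pi.single x a + Pi.single y b + z • (Pi.single y 1 : X → ℂ) =
          Pi.single x a + Pi.single y (b + z) := by
        rw [← Pi.single_smul, Pi.single_add, add_assoc, smul_eq_mul, mul_one]
      rw [this]
      exact hmem x y hxy _ _) h0).1
    have hx := (apply_vecMulVec_eq_zero (u := Pi.single x 1) hpos (fun z => by
      have : Pi.single x a + Pi.single y b + z • (Pi.single x 1 : X → ℂ) =
          Pi.single x (a + z) + Pi.single y b := by
        rw [← Pi.single_smul, Pi.single_add, smul_eq_mul, mul_one, add_right_comm]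
      rw [this]
      exact hmem x y hxy _ _) h0).2
    simp only [star_add, ← Pi.single_star, star_one, add_vecMulVec, vecMulVec_add, map_add,
      hsingle] at hx hy
    simp only [mul_one, one_mul] at hx hy
    exact ⟨hy, hx⟩
  have hleft : ∀ x y, R x y → v x = 0 → p x y = 0 := fun x y hxy hx => by
    simpa using (hedge x y hxy 1 0 (by simp [hx])).1
  have hright : ∀ x y, R x y → v y = 0 → p x y = 0 := fun x y hxy hy => by
    simpa using (hedge x y hxy 0 1 (by simp [hy])).2
  have hcross : ∀ x y, R x y →
      star (v y) * p x y = star (v x) * p y y ∧ v y * p x x = v x * p x y := by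
    intro x y hxy
    obtain ⟨h1, h2⟩ := hedge x y hxy (star (v y)) (-star (v x)) (by
      simp only [star_neg, star_star]; ring)
    simp only [star_neg, star_star] at h1 h2
    exact ⟨by linear_combination h1, by linear_combination h2⟩
  have hratio : ∀ x y, Relation.EqvGen (fun a b => v a ≠ 0 ∧ v b ≠ 0 ∧ R a b) x y →
      p x x / (star (v x) * v x) = p y y / (star (v y) * v y) := by
    intro x y h
    induction h with
    | rel x y h =>
      obtain ⟨hx, hy, hxy⟩ := h
      obtain ⟨h1, h2⟩ := hcross x y hxy
      have hx' := star_ne_zero.2 hx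
      have hy' := star_ne_zero.2 hy
      rw [div_eq_div_iff (mul_ne_zero hx' hx) (mul_ne_zero hy' hy)]
      linear_combination v x * h1 + star (v y) * h2
    | refl x => rfl
    | symm x y _ ih => exact ih.symm
    | trans x y z _ _ ih₁ ih₂ => exact ih₁.trans ih₂
  have hnorm : ∑ x, star (v x) * v x = 1 := by
    have : ∑ x, star (v x) * v x = ((∑ x, ‖v x‖ ^ 2 : ℝ) : ℂ) := by
      simp [Complex.conj_mul']
    rw [this, hv, Complex.ofReal_one]
  obtain ⟨x₀, hx₀⟩ : ∃ x, v x ≠ 0 := by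
    by_contra! h
    simp [h] at hv
  have hdiag : ∀ x, p x x = p x₀ x₀ / (star (v x₀) * v x₀) * (star (v x) * v x) := by
    intro x
    by_cases hx : v x = 0
    · simp [hx, hleft x x (hrefl x) hx]
    · rw [hratio x₀ x (hconn x₀ hx₀ x hx), div_mul_cancel₀]
      exact mul_ne_zero (star_ne_zero.2 hx) hx
  have hsum : ∑ x, p x x = 1 := by
    rw [← hΨ, hp, ← map_sum]
    congr 1
    ext s t
    simp [Matrix.sum_apply, Matrix.single_apply, Matrix.one_apply, ite_and]
  have hc : p x₀ x₀ / (star (v x₀) * v x₀) = 1 := by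
    rw [Finset.sum_congr rfl fun x _ => hdiag x, ← Finset.mul_sum, hnorm, mul_one] at hsum
    exact hsum
  have hentry : ∀ x y, R x y → p x y = star (v x) * v y := by
    intro x y hxy
    by_cases hx : v x = 0
    · simp [hx, hleft x y hxy hx]
    · have h := (hcross x y hxy).2
      rw [hdiag x, hc] at h
      exact mul_left_cancel₀ hx (by linear_combination -h)
  rw [vectorFunctional_apply]
  conv_lhs => rw [Matrix.matrix_eq_sum_single B]
  simp only [map_sum]
  refine Finset.sum_congr rfl fun x _ => Finset.sum_congr rfl fun y _ => ?_
  have : Matrix.single x y (B x y) = B x y • Matrix.single x y (1 : ℂ) := by simp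
  rw [this, map_smul, smul_eq_mul]
  by_cases hxy : R x y
  · change B x y * p x y = _
    rw [hentry x y hxy, Complex.star_def]
    ring
  · simp [(hE B).1 hB x y hxy]

/-- If no entry of `B` links the support of `v` inside `C` to that outside `C`, the vector
functional of `v` at `B` splits along `C`. -/
theorem vectorFunctional_eq_indicator_add {X : Type*} [Fintype X] {v : X → ℂ} {C : Set X}
    {B : Matrix X X ℂ}
    (h : ∀ x y, v x ≠ 0 → v y ≠ 0 → ¬ (x ∈ C ↔ y ∈ C) → B x y = 0) :
    vectorFunctional v B =
      vectorFunctional (C.indicator v) B + vectorFunctional (Cᶜ.indicator v) B := by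
  classical
  simp only [vectorFunctional_apply, ← Finset.sum_add_distrib]
  refine Finset.sum_congr rfl fun x _ => Finset.sum_congr rfl fun y _ => ?_
  have hxy := h x y
  by_cases hx : v x = 0
  · simp [Set.indicator_apply, hx]
  by_cases hy : v y = 0
  · simp [Set.indicator_apply, hy]
  by_cases hxC : x ∈ C <;> by_cases hyC : y ∈ C <;> simp_all

/-- The normalised vector functional is a state. -/
theorem smul_vectorFunctional_mem_states {X : Type*} [Fintype X] [DecidableEq X]
    {E : Submodule ℂ (Matrix X X ℂ)} (hone : (1 : Matrix X X ℂ) ∈ E) {w : X → ℂ} {t : ℝ}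
    (ht : 0 < t) (hw : ∑ x, ‖w x‖ ^ 2 = t) :
    t⁻¹ • (vectorFunctional w ∘ₗ E.subtype) ∈ {ψ : E →ₗ[ℂ] ℂ |
      (∀ B : E, (B : Matrix X X ℂ).PosSemidef → 0 ≤ ψ B) ∧ ψ ⟨1, hone⟩ = 1} := by
  refine ⟨fun B hB => smul_nonneg (inv_nonneg.2 ht.le) (vectorFunctional_nonneg w hB), ?_⟩
  have : (t : ℂ) ≠ 0 := by exact_mod_cast ht.ne'
  simp only [LinearMap.smul_apply, LinearMap.comp_apply, Submodule.subtype_apply,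
    vectorFunctional_one, hw, Complex.real_smul, Complex.ofReal_inv]
  exact inv_mul_cancel₀ this

/-- For a unit vector `v` with support `S`, the vector state `φ_v` restricted to
the operator system `E(R)` is pure (an extreme point of the state space of `E(R)`) iff the
restriction of `R` to `S` generates the full equivalence relation on `S`. -/
theorem stmt7 {X : Type*} [Fintype X] [DecidableEq X] (R : X → X → Prop)
    (hrefl : ∀ x, R x x) (hsymm : ∀ x y, R x y → R y x)
    (E : Submodule ℂ (Matrix X X ℂ))
    (hE : ∀ B : Matrix X X ℂ, B ∈ E ↔ ∀ x y, ¬ R x y → B x y = 0)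
    (hone : (1 : Matrix X X ℂ) ∈ E)
    (v : X → ℂ) (hv : ∑ x, ‖v x‖ ^ 2 = 1)
    (S : Set X) (hS : S = {x | v x ≠ 0})
    (φ : E →ₗ[ℂ] ℂ)
    (hφ : ∀ B : E, φ B = ∑ x, ∑ y, starRingEnd ℂ (v x) * (B : Matrix X X ℂ) x y * v y) :
    φ ∈ Set.extremePoints ℝ {ψ : E →ₗ[ℂ] ℂ |
        (∀ B : E, (B : Matrix X X ℂ).PosSemidef → 0 ≤ ψ B) ∧ ψ ⟨1, hone⟩ = 1} ↔
      ∀ x ∈ S, ∀ y ∈ S,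
        Relation.EqvGen (fun a b => a ∈ S ∧ b ∈ S ∧ R a b) x y := by
  subst hS
  obtain rfl : φ = vectorFunctional v ∘ₗ E.subtype :=
    LinearMap.ext fun B => by rw [hφ, LinearMap.comp_apply, vectorFunctional_apply]; rfl
  rw [mem_extremePoints_iff_left]
  constructor
  · rintro ⟨-, hext⟩ x hx y hy
    by_contra hxy
    set r : X → X → Prop := fun a b => a ∈ {x | v x ≠ 0} ∧ b ∈ {x | v x ≠ 0} ∧ R a b
    set C : Set X := {z | Relation.EqvGen r x z}
    have hxC : x ∈ C := Relation.EqvGen.refl x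
    have hyC : y ∉ C := hxy
    have hcut : ∀ a b, v a ≠ 0 → v b ≠ 0 → R a b → (a ∈ C ↔ b ∈ C) := fun a b ha hb hab =>
      have hab' : Relation.EqvGen r a b := Relation.EqvGen.rel _ _ ⟨ha, hb, hab⟩
      ⟨fun h => h.trans _ _ _ hab', fun h => h.trans _ _ _ (hab'.symm _ _)⟩
    have hpos : ∀ (D : Set X) (z : X), z ∈ D → v z ≠ 0 →
        0 < ∑ a, ‖D.indicator v a‖ ^ 2 := fun D z hz hvz =>
      Finset.sum_pos' (fun _ _ => sq_nonneg _) ⟨z, Finset.mem_univ _, by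
        rw [Set.indicator_of_mem hz]
        exact pow_pos (norm_pos_iff.2 hvz) 2⟩
    have hs := hpos C x hxC hx
    have ht := hpos Cᶜ y hyC hy
    set s := ∑ a, ‖C.indicator v a‖ ^ 2 with hs_def
    set t := ∑ a, ‖Cᶜ.indicator v a‖ ^ 2 with ht_def
    have hst : s + t = 1 := by
      rw [← hv, hs_def, ht_def, ← Finset.sum_add_distrib]
      refine Finset.sum_congr rfl fun a _ => ?_
      by_cases ha : a ∈ C <;> simp [ha]
    have heq := hext _ (smul_vectorFunctional_mem_states hone hs rfl)
      _ (smul_vectorFunctional_mem_states hone ht rfl) ⟨s, t, hs, ht, hst, by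
        rw [smul_smul, smul_smul, mul_inv_cancel₀ hs.ne', mul_inv_cancel₀ ht.ne', one_smul,
          one_smul]
        refine LinearMap.ext fun B => (vectorFunctional_eq_indicator_add ?_).symm
        exact fun a b ha hb hab => (hE B).1 B.2 a b fun h => hab (hcut a b ha hb h)⟩
    have hmem : Matrix.single y y (1 : ℂ) ∈ E := (hE _).2 fun a b hab => by
      refine Matrix.single_apply_of_ne _ _ _ _ _ ?_
      rintro ⟨rfl, rfl⟩
      exact hab (hrefl _)
    have h := LinearMap.congr_fun heq ⟨_, hmem⟩
    simp only [LinearMap.smul_apply, LinearMap.comp_apply, Submodule.subtype_apply,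
      vectorFunctional_single, Set.indicator_of_notMem hyC, mul_zero, smul_zero] at h
    exact mul_ne_zero (star_ne_zero.2 hy) hy h.symm
  · intro hconn
    have hstate := smul_vectorFunctional_mem_states hone one_pos hv
    rw [inv_one, one_smul] at hstate
    refine ⟨hstate, ?_⟩
    rintro ψ₁ ⟨hpos₁, hone₁⟩ ψ₂ ⟨hpos₂, -⟩ ⟨s, t, hs, ht, -, hst⟩
    obtain ⟨Ψ, rfl⟩ := ψ₁.exists_extend
    refine LinearMap.ext fun B => eq_vectorFunctional_of_connected hrefl hsymm hE hv hconn
      (fun A hA => hpos₁ ⟨A, hA⟩) hone₁ (fun w hw horth => ?_) B.2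
    have hw_pos := posSemidef_vecMulVec_self_star w
    have h := LinearMap.congr_fun hst ⟨_, hw⟩
    simp only [LinearMap.add_apply, LinearMap.smul_apply, LinearMap.comp_apply,
      Submodule.subtype_apply, vectorFunctional_vecMulVec horth] at h
    have h₁ := hpos₁ ⟨_, hw⟩ hw_pos
    have h₂ := hpos₂ ⟨_, hw⟩ hw_pos
    have h₀ := ((add_eq_zero_iff_of_nonneg (smul_nonneg hs.le h₁) (smul_nonneg ht.le h₂)).1 h).1
    exact (smul_eq_zero.1 h₀).resolve_left hs.ne'
end

section
/- Let X be a finite set, R a reflexive and symmetric relation on X, and v ∈ ℂ^X with support S := { x ∈ X : v x ≠ 0 }. Assume the restriction of R to S generates the full equivalence relation on S (for all x, y ∈ S, the pair (x,y) lies in the equivalence relation generated by { (a,b) ∈ R : a ∈ S and b ∈ S }). If w ∈ ℂ^X satisfies Σ_{x,y} conj(w x) · B x y · w y ≤ Σ_{x,y} conj(v x) · B x y · v y (as real numbers) for every positive semidefinite B ∈ E(R), then there exists c ∈ ℂ with w = c • v. -/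
open scoped ComplexOrder

/-- The quadratic form of the rank-one matrix `star u ⊗ u` at `z` is `|u ⬝ᵥ z|²`. -/
theorem sum_vecMulVec_star_self {X : Type*} [Fintype X] (u z : X → ℂ) :
    ∑ x, ∑ y, starRingEnd ℂ (z x) * Matrix.vecMulVec (star u) u x y * z y =
      starRingEnd ℂ (u ⬝ᵥ z) * (u ⬝ᵥ z) := by
  simp only [dotProduct, map_sum, map_mul, Finset.sum_mul_sum]
  refine Finset.sum_congr rfl fun x _ => Finset.sum_congr rfl fun y _ => ?_
  simp only [Matrix.vecMulVec_apply, Pi.star_apply, starRingEnd_apply]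
  ring

/-- If the support of `u` is an `R`-clique, then the form inequality for all positive
semidefinite `B ∈ E(R)` forces `u ⬝ᵥ w = 0` whenever `u ⬝ᵥ v = 0`. -/
theorem dotProduct_eq_zero_of_form_le {X : Type*} [Fintype X] {R : X → X → Prop}
    {v w : X → ℂ}
    (hw : ∀ B : Matrix X X ℂ, (∀ x y, ¬ R x y → B x y = 0) → B.PosSemidef →
      ∑ x, ∑ y, starRingEnd ℂ (w x) * B x y * w y ≤
        ∑ x, ∑ y, starRingEnd ℂ (v x) * B x y * v y)
    {u : X → ℂ} (hu : ∀ x y, u x ≠ 0 → u y ≠ 0 → R x y) (huv : u ⬝ᵥ v = 0) :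
    u ⬝ᵥ w = 0 := by
  have h := hw (Matrix.vecMulVec (star u) u) (fun x y hxy => by
    by_contra hne
    simp only [Matrix.vecMulVec_apply, Pi.star_apply, mul_eq_zero, star_eq_zero,
      not_or] at hne
    exact hxy (hu x y hne.1 hne.2)) (Matrix.posSemidef_vecMulVec_star_self u)
  rw [sum_vecMulVec_star_self, sum_vecMulVec_star_self, huv, mul_zero,
    ← Complex.normSq_eq_conj_mul_self] at h
  have h' : Complex.normSq (u ⬝ᵥ w) ≤ 0 := by exact_mod_cast h
  exact Complex.normSq_eq_zero.1 (le_antisymm h' (Complex.normSq_nonneg _))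

/-- If the restriction of `R` to the support `S` of `v` generates the full
equivalence relation on `S`, and `w` satisfies `⟨w, B w⟩ ≤ ⟨v, B v⟩` for every positive
semidefinite `B ∈ E(R)`, then `w` is a scalar multiple of `v`. -/
theorem stmt8 {X : Type*} [Fintype X] [DecidableEq X] (R : X → X → Prop)
    (hrefl : ∀ x, R x x) (hsymm : ∀ x y, R x y → R y x)
    (v : X → ℂ) (S : Set X) (hS : S = {x | v x ≠ 0})
    (hconn : ∀ x ∈ S, ∀ y ∈ S,
      Relation.EqvGen (fun a b => a ∈ S ∧ b ∈ S ∧ R a b) x y)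
    (w : X → ℂ)
    (hw : ∀ B : Matrix X X ℂ, (∀ x y, ¬ R x y → B x y = 0) → B.PosSemidef →
      ∑ x, ∑ y, starRingEnd ℂ (w x) * B x y * w y ≤
        ∑ x, ∑ y, starRingEnd ℂ (v x) * B x y * v y) :
    ∃ c : ℂ, w = c • v := by
  subst hS
  have hzero : ∀ x, v x = 0 → w x = 0 := fun x hx => by
    have h := dotProduct_eq_zero_of_form_le hw (u := Pi.single x 1)
      (fun a b ha hb => by
        obtain rfl : a = x := by_contra fun h => ha (Pi.single_eq_of_ne h _)
        obtain rfl : b = a := by_contra fun h => hb (Pi.single_eq_of_ne h _)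
        exact hrefl _) (by simpa using hx)
    simpa using h
  have hedge : ∀ a b, R a b → v b * w a = v a * w b := fun a b hab => by
    have h := dotProduct_eq_zero_of_form_le hw
      (u := Pi.single a (v b) - Pi.single b (v a))
      (fun x y hx hy => by
        have hmem : ∀ z, (Pi.single a (v b) - Pi.single b (v a) : X → ℂ) z ≠ 0 →
            z = a ∨ z = b := fun z hz => by
          by_contra! hne
          exact hz (by simp [hne.1, hne.2])
        rcases hmem x hx with rfl | rfl <;> rcases hmem y hy with rfl | rfl
        exacts [hrefl _, hab, hsymm _ _ hab, hrefl _])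
      (by simp [sub_dotProduct, mul_comm])
    simpa [sub_dotProduct, sub_eq_zero] using h
  have hratio : ∀ x y, Relation.EqvGen
      (fun a b => a ∈ {x | v x ≠ 0} ∧ b ∈ {x | v x ≠ 0} ∧ R a b) x y →
      w x / v x = w y / v y := fun x y h => by
    induction h with
    | rel a b h =>
      obtain ⟨ha, hb, hab⟩ := h
      rw [div_eq_div_iff ha hb]
      linear_combination hedge a b hab
    | refl => rfl
    | symm _ _ _ ih => exact ih.symm
    | trans _ _ _ _ _ ih₁ ih₂ => exact ih₁.trans ih₂
  by_cases hne : ∃ x, v x ≠ 0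
  · obtain ⟨x, hx⟩ := hne
    refine ⟨w x / v x, funext fun y => ?_⟩
    by_cases hy : v y = 0
    · simp [hy, hzero y hy]
    · rw [hratio x y (hconn x hx y hy), Pi.smul_apply, smul_eq_mul, div_mul_cancel₀ _ hy]
  · push Not at hne
    exact ⟨0, funext fun y => by simp [hzero y (hne y)]⟩
end

section
/- Let (X,d) be a proper metric space satisfying the path-metric property: for all x, y ∈ X, all r₁, r₂ > 0 with r₁ + r₂ ≤ d(x,y), and all δ > 0, there exist points p, q ∈ X with d(x,p) ≤ r₁, d(y,q) ≤ r₂ and d(p,q) ≤ d(x,y) − r₁ − r₂ + δ. Then for all ε, ε' > 0 and all x, y ∈ X: d(x,y) < ε + ε' if and only if there exists z ∈ X with d(x,z) < ε and d(z,y) < ε'. In other words, the composition of the relations R_ε = {(x,y) : d(x,y) < ε} and R_{ε'} equals R_{ε+ε'}. -/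
/-- In a proper path metric space, the composition of the relations
`R_ε = {(x,y) : d(x,y) < ε}` and `R_ε'` equals `R_{ε+ε'}`. -/
theorem stmt9 {X : Type*} [MetricSpace X] [ProperSpace X]
    (hpath : ∀ x y : X, ∀ r₁ r₂ : ℝ, 0 < r₁ → 0 < r₂ → r₁ + r₂ ≤ dist x y →
      ∀ δ : ℝ, 0 < δ → ∃ p q : X,
        dist x p ≤ r₁ ∧ dist y q ≤ r₂ ∧ dist p q ≤ dist x y - r₁ - r₂ + δ) :
    ∀ ε ε' : ℝ, 0 < ε → 0 < ε' → ∀ x y : X,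
      dist x y < ε + ε' ↔ ∃ z : X, dist x z < ε ∧ dist z y < ε' := by
  intro ε ε' hε hε' x y
  constructor
  · intro h
    rcases (dist_nonneg (x := x) (y := y)).eq_or_lt with h0 | h0
    · exact ⟨x, by simpa using hε, h0 ▸ hε'⟩
    have hs : 0 < ε + ε' := add_pos hε hε'
    obtain ⟨t, ht⟩ : ∃ t, t = dist x y / (ε + ε') := ⟨_, rfl⟩
    have ht0 : 0 < t := ht ▸ div_pos h0 hs
    have ht1 : t < 1 := ht ▸ (div_lt_one hs).2 h
    have hsum : t * ε + t * ε' = dist x y := by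
      rw [ht]
      field_simp
    have h₁ : t * ε < ε := mul_lt_of_lt_one_left hε ht1
    have h₂ : t * ε' < ε' := mul_lt_of_lt_one_left hε' ht1
    obtain ⟨p, q, hp, hq, hpq⟩ := hpath x y (t * ε) (t * ε') (mul_pos ht0 hε)
      (mul_pos ht0 hε') hsum.le ((ε' - t * ε') / 2) (by linarith)
    refine ⟨p, hp.trans_lt h₁, ?_⟩
    have := dist_triangle_right p y q
    linarith
  · rintro ⟨z, h₁, h₂⟩
    exact (dist_triangle x z y).trans_lt (add_lt_add h₁ h₂)
end

section
/- Let A be a complex C*-algebra, e ∈ A with 0 ≤ e, n a positive integer, t ≥ 0 a real number, and x an n×n matrix over A which is Hermitian (equal to its conjugate transpose, x_{ji} = (x_{ij})* for all i,j). Suppose that for all i, j one has −t·e ≤ (x_{ij} + (x_{ij})*)/2 ≤ t·e and −t·e ≤ (x_{ij} − (x_{ij})*)/(2i) ≤ t·e in A. Then, in the C*-algebra of n×n matrices over A, one has −(2·n·t)·D ≤ x ≤ (2·n·t)·D, where D is the diagonal matrix with every diagonal entry equal to e. -/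
open Matrix

/-- In a C*-algebra, finite sums of elements `z* z` are again of this form. -/
theorem exists_sum_eq_star_mul_self {B ι : Type*} [NonUnitalCStarAlgebra B] (s : Finset ι)
    (f : ι → B) (hf : ∀ i ∈ s, ∃ z, f i = star z * z) : ∃ z, ∑ i ∈ s, f i = star z * z := by
  let _ : PartialOrder B := CStarAlgebra.spectralOrder B
  have : StarOrderedRing B := CStarAlgebra.spectralOrderedRing B
  simp only [← CStarAlgebra.nonneg_iff_eq_star_mul_self] at hf ⊢
  exact Finset.sum_nonneg hf

/-- Finite sums of matrices `z* z` over a C*-algebra are again of this form. -/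
theorem Matrix.exists_sum_eq_star_mul_self {A ι m : Type*} [NonUnitalCStarAlgebra A] [Fintype m]
    (s : Finset ι) (f : ι → Matrix m m A)
    (hf : ∀ i ∈ s, ∃ z, f i = star z * z) : ∃ z, ∑ i ∈ s, f i = star z * z := by
  let _ : PartialOrder A := CStarAlgebra.spectralOrder A
  have : StarOrderedRing A := CStarAlgebra.spectralOrderedRing A
  exact _root_.exists_sum_eq_star_mul_self (B := CStarMatrix m m A) s f hf

/-- The matrix `v v* ⊗ p` is positive whenever `p` is. -/
theorem Matrix.exists_vecMulVec_smul_eq_star_mul_self {A m : Type*} [NonUnitalCStarAlgebra A]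
    [PartialOrder A] [StarOrderedRing A] [Fintype m] [DecidableEq m] [Nonempty m] {p : A}
    (hp : 0 ≤ p) (v : m → ℂ) :
    ∃ z : Matrix m m A, (of fun k l => (v k * star (v l)) • p) = star z * z := by
  obtain ⟨q, rfl⟩ := CStarAlgebra.nonneg_iff_eq_star_mul_self.mp hp
  obtain ⟨o⟩ := ‹Nonempty m›
  refine ⟨of fun k l => if k = o then star (v l) • q else 0, ?_⟩
  ext k l
  rw [mul_apply, Finset.sum_eq_single o]
  · simp [star_apply, star_smul, smul_mul_smul_comm]
  · intro b _ hb
    simp [hb]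
  · simp

/-- If the real and imaginary parts of `y` are bounded by `f`, then the Hermitian matrix with
entries `y / 2` at `(i, j)` and `y* / 2` at `(j, i)` becomes positive after adding `f` at `(i, i)`
and at `(j, j)`. -/
theorem Matrix.exists_single_add_single_eq_star_mul_self {A m : Type*} [NonUnitalCStarAlgebra A]
    [PartialOrder A] [StarOrderedRing A] [Fintype m] [DecidableEq m] {f y : A}
    (hre₁ : -f ≤ (1 / 2 : ℂ) • (y + star y)) (hre₂ : (1 / 2 : ℂ) • (y + star y) ≤ f)
    (him₁ : -f ≤ (-Complex.I / 2) • (y - star y)) (him₂ : (-Complex.I / 2) • (y - star y) ≤ f)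
    (i j : m) :
    ∃ z : Matrix m m A,
      single i i f + single j j f + (1 / 2 : ℂ) • (single i j y + single j i (star y))
        = star z * z := by
  have : Nonempty m := ⟨i⟩
  set a := (1 / 2 : ℂ) • (y + star y) with ha
  set b := (-Complex.I / 2) • (y - star y) with hb
  have hquarter (p : A) (hp : 0 ≤ p) : 0 ≤ (1 / 4 : ℝ) • p := smul_nonneg (by norm_num) hp
  let v (c : ℂ) : m → ℂ := Pi.single i 1 + c • Pi.single j 1
  let p : Fin 4 → A := ![f + a, f - a, f + b, f - b]
  let c : Fin 4 → ℂ := ![1, -1, -Complex.I, Complex.I]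
  have hp : ∀ r, 0 ≤ p r := by
    intro r
    fin_cases r
    · simpa [p] using neg_le_iff_add_nonneg'.mp hre₁
    · simpa [p] using hre₂
    · simpa [p] using neg_le_iff_add_nonneg'.mp him₁
    · simpa [p] using him₂
  obtain ⟨z, hz⟩ := Matrix.exists_sum_eq_star_mul_self Finset.univ
    (fun r => of fun k l => (v (c r) k * star (v (c r) l)) • ((1 / 4 : ℝ) • p r))
    (fun r _ => Matrix.exists_vecMulVec_smul_eq_star_mul_self (hquarter _ (hp r)) _)
  refine ⟨z, hz ▸ ?_⟩
  have hI : Complex.I * Complex.I = -1 := Complex.I_mul_I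
  have hI2 : Complex.I * (-Complex.I / 2) = 1 / 2 := by linear_combination (-1 / 2) * hI
  have hy : y = a + Complex.I • b := by
    rw [ha, hb, smul_smul, hI2]
    module
  have hy' : star y = a - Complex.I • b := by
    rw [ha, hb, smul_smul, hI2]
    module
  clear_value a b
  rw [hy', hy]
  have hr (u : A) : (1 / 4 : ℝ) • u = (1 / 4 : ℂ) • u := by
    rw [← Complex.coe_smul]; norm_num
  have hsingle (i j k l : m) (u : A) : single i j u k l
      = ((Pi.single i 1 : m → ℂ) k * (Pi.single j 1 : m → ℂ) l) • u := by
    by_cases hk : k = i <;> by_cases hl : l = j <;>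
      simp [hk, hl, Ne.symm]
  have hstarI : star Complex.I = -Complex.I := Complex.conj_I
  have hstar (i k : m) : star ((Pi.single i 1 : m → ℂ) k) = (Pi.single i 1 : m → ℂ) k := by
    by_cases h : k = i <;> simp [h]
  ext k l
  simp only [hr, Fin.sum_univ_four, p, c, v, Matrix.add_apply, Matrix.smul_apply, hsingle,
    of_apply, Pi.add_apply, Pi.smul_apply, Matrix.cons_val, star_add, star_mul', hstar,
    smul_eq_mul, star_neg, star_one, hstarI]
  match_scalars
  · linear_combination (1 / 2 * (Pi.single j 1 : m → ℂ) k * (Pi.single j 1 : m → ℂ) l) * hI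
  · ring
  · ring

/-- A Hermitian matrix whose entries have real and imaginary parts bounded by `f` is bounded below
by `-2 |m| diag(f, …, f)`. -/
theorem Matrix.exists_add_diagonal_eq_star_mul_self {A m : Type*} [NonUnitalCStarAlgebra A]
    [PartialOrder A] [StarOrderedRing A] [Fintype m] [DecidableEq m] {f : A} {x : Matrix m m A}
    (hx : star x = x)
    (hre : ∀ i j, -f ≤ (1 / 2 : ℂ) • (x i j + star (x i j)) ∧
      (1 / 2 : ℂ) • (x i j + star (x i j)) ≤ f)
    (him : ∀ i j, -f ≤ (-Complex.I / 2) • (x i j - star (x i j)) ∧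
      (-Complex.I / 2) • (x i j - star (x i j)) ≤ f) :
    ∃ z : Matrix m m A,
      x + (2 * Fintype.card m : ℂ) • diagonal (fun _ => f) = star z * z := by
  obtain ⟨z, hz⟩ := Matrix.exists_sum_eq_star_mul_self Finset.univ
    (fun r : m × m => single r.1 r.1 f + single r.2 r.2 f +
      (1 / 2 : ℂ) • (single r.1 r.2 (x r.1 r.2) + single r.2 r.1 (star (x r.1 r.2))))
    (fun r _ => Matrix.exists_single_add_single_eq_star_mul_self (hre _ _).1 (hre _ _).2
      (him _ _).1 (him _ _).2 _ _)
  refine ⟨z, hz ▸ ?_⟩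
  have hD : ∑ i : m, single i i f = diagonal fun _ => f := by
    rw [← Matrix.sum_single_eq_diagonal]
  have hx₁ : ∑ i, ∑ j, single i j (x i j) = x := (matrix_eq_sum_single x).symm
  have hx₂ : ∑ i, ∑ j, single j i (star (x i j)) = x := by
    rw [Finset.sum_comm]
    conv_rhs => rw [← hx, matrix_eq_sum_single (star x)]
    rfl
  rw [Fintype.sum_prod_type]
  simp only [Finset.sum_add_distrib, ← Finset.smul_sum, hx₁, hx₂, Finset.sum_const, hD,
    Finset.card_univ, ← Nat.cast_smul_eq_nsmul ℂ]
  module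

/-- Let `A` be a C*-algebra, `0 ≤ e`, and `x` a Hermitian `n × n` matrix over
`A` whose entries have real and imaginary parts bounded by `t • e`. Then, in the C*-algebra
of `n × n` matrices over `A` (where an element is positive iff it is of the form `z* z`),
one has `-(2 n t) • D ≤ x ≤ (2 n t) • D` with `D = diag(e, …, e)`. -/
theorem stmt10 {A : Type*} [NonUnitalNormedRing A] [StarRing A] [CStarRing A]
    [NormedSpace ℂ A] [StarModule ℂ A] [SMulCommClass ℂ A A] [IsScalarTower ℂ A A]
    [CompleteSpace A] [PartialOrder A] [StarOrderedRing A]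
    (e : A) (he : 0 ≤ e) (n : ℕ) (hn : 0 < n) (t : ℝ) (ht : 0 ≤ t)
    (x : Matrix (Fin n) (Fin n) A) (hx : star x = x)
    (hre : ∀ i j, -((t : ℂ) • e) ≤ (1 / 2 : ℂ) • (x i j + star (x i j)) ∧
      (1 / 2 : ℂ) • (x i j + star (x i j)) ≤ (t : ℂ) • e)
    (him : ∀ i j, -((t : ℂ) • e) ≤ (-Complex.I / 2) • (x i j - star (x i j)) ∧
      (-Complex.I / 2) • (x i j - star (x i j)) ≤ (t : ℂ) • e) :
    (∃ z : Matrix (Fin n) (Fin n) A,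
      x + ((2 * n * t : ℝ) : ℂ) • Matrix.diagonal (fun _ => e) = star z * z) ∧
    (∃ z : Matrix (Fin n) (Fin n) A,
      ((2 * n * t : ℝ) : ℂ) • Matrix.diagonal (fun _ => e) - x = star z * z) := by
  let _ : NonUnitalCStarAlgebra A := {}
  have hscale : ((2 * n * t : ℝ) : ℂ) • diagonal (fun _ : Fin n => e)
      = (2 * Fintype.card (Fin n) : ℂ) • diagonal (fun _ : Fin n => (t : ℂ) • e) := by
    ext i j
    rcases eq_or_ne i j with rfl | h
    · simp [smul_smul, -Complex.coe_smul]
    · simp [h]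
  rw [hscale]
  refine ⟨Matrix.exists_add_diagonal_eq_star_mul_self hx hre him, ?_⟩
  rw [sub_eq_neg_add]
  refine Matrix.exists_add_diagonal_eq_star_mul_self (by rw [star_neg, hx])
    (fun i j => ?_) (fun i j => ?_)
  · have h : (1 / 2 : ℂ) • ((-x) i j + star ((-x) i j))
        = -((1 / 2 : ℂ) • (x i j + star (x i j))) := by
      rw [Matrix.neg_apply, star_neg]; module
    rw [h]
    exact ⟨neg_le_neg (hre i j).2, neg_le.mp (hre i j).1⟩
  · have h : (-Complex.I / 2) • ((-x) i j - star ((-x) i j))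
        = -((-Complex.I / 2) • (x i j - star (x i j))) := by
      rw [Matrix.neg_apply, star_neg]; module
    rw [h]
    exact ⟨neg_le_neg (him i j).2, neg_le.mp (him i j).1⟩
end

section
/- Let A be a complex C*-algebra, E ⊆ A a closed *-subspace, 𝓐 ⊆ A a dense *-subspace with 𝓔 := E ∩ 𝓐 dense in E, and (e_λ)_{λ∈Λ} a norm-defining approximate order unit for 𝓐 contained in 𝓔. Then a state φ on E is an extreme point of the set of states on E if and only if φ is an extreme point of the set of quasi-states on E. -/
open scoped ComplexOrder

/-- If a bounded functional of norm one lies in an open segment whose endpoints have norm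
at most one, then the left endpoint has norm one. -/
theorem norm_left_eq_one_of_mem_openSegment {V : Type*} [SeminormedAddCommGroup V]
    [NormedSpace ℂ V] {x y z : V →L[ℂ] ℂ} (hx : ‖x‖ ≤ 1) (hy : ‖y‖ ≤ 1) (hz : ‖z‖ = 1)
    (h : z ∈ openSegment ℝ x y) : ‖x‖ = 1 := by
  obtain ⟨a, b, ha, hb, hab, rfl⟩ := h
  have hle : ‖a • x + b • y‖ ≤ a * ‖x‖ + b * ‖y‖ := by
    simpa [norm_smul, abs_of_pos ha, abs_of_pos hb] using norm_add_le (a • x) (b • y)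
  refine le_antisymm hx (le_of_not_gt fun hlt => ?_)
  nlinarith [mul_lt_mul_of_pos_left hlt ha, mul_le_mul_of_nonneg_left hy hb.le]

/-- Under the approximate-order-unit hypotheses, a state `φ` on `E` is an
extreme point of the set of states on `E` iff it is an extreme point of the set of
quasi-states on `E`. -/
theorem stmt12 {A : Type*} [NonUnitalNormedRing A] [StarRing A] [CStarRing A]
    [NormedSpace ℂ A] [StarModule ℂ A] [SMulCommClass ℂ A A] [IsScalarTower ℂ A A]
    [CompleteSpace A] [PartialOrder A] [StarOrderedRing A]
    (E : Submodule ℂ A) (hEclosed : IsClosed (E : Set A)) (hEstar : ∀ x ∈ E, star x ∈ E)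
    (𝓐 : Submodule ℂ A) (h𝓐dense : Dense (𝓐 : Set A)) (h𝓐star : ∀ x ∈ 𝓐, star x ∈ 𝓐)
    (h𝓔dense : (E : Set A) ⊆ closure ((E ⊓ 𝓐 : Submodule ℂ A) : Set A))
    {Λ : Type*} [Nonempty Λ] [Preorder Λ] [IsDirected Λ (· ≤ ·)]
    (e : Λ → A) (heE : ∀ l, e l ∈ E) (he𝓐 : ∀ l, e l ∈ 𝓐)
    (hepos : ∀ l, 0 ≤ e l) (hemono : Monotone e)
    (hnorm : ∀ x ∈ 𝓐, ‖x‖ = sInf {t : ℝ | 0 ≤ t ∧ ∃ l : Λ,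
      ∃ z : Matrix (Fin 2) (Fin 2) A,
        !![(t : ℂ) • e l, x; star x, (t : ℂ) • e l] = star z * z})
    (φ : E →L[ℂ] ℂ) (hφpos : ∀ x : E, 0 ≤ (x : A) → 0 ≤ φ x) (hφnorm : ‖φ‖ = 1) :
    φ ∈ Set.extremePoints ℝ
        {ψ : E →L[ℂ] ℂ | (∀ x : E, 0 ≤ (x : A) → 0 ≤ ψ x) ∧ ‖ψ‖ = 1} ↔
      φ ∈ Set.extremePoints ℝ
        {ψ : E →L[ℂ] ℂ | (∀ x : E, 0 ≤ (x : A) → 0 ≤ ψ x) ∧ ‖ψ‖ ≤ 1} := by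
  constructor
  · rintro ⟨-, hext⟩
    refine ⟨⟨hφpos, hφnorm.le⟩, fun ψ₁ h₁ ψ₂ h₂ hseg => ?_⟩
    have hseg' := hseg
    rw [openSegment_symm] at hseg'
    exact hext ⟨h₁.1, norm_left_eq_one_of_mem_openSegment h₁.2 h₂.2 hφnorm hseg⟩
      ⟨h₂.1, norm_left_eq_one_of_mem_openSegment h₂.2 h₁.2 hφnorm hseg'⟩ hseg
  · rintro ⟨-, hext⟩
    exact ⟨⟨hφpos, hφnorm⟩, fun ψ₁ h₁ ψ₂ h₂ hseg =>
      hext ⟨h₁.1, h₁.2.le⟩ ⟨h₂.1, h₂.2.le⟩ hseg⟩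
end

section
/- Let A be a complex C*-algebra, E ⊆ A a closed *-subspace, 𝓐 ⊆ A a dense *-subspace with 𝓔 := E ∩ 𝓐 dense in E, and (e_λ)_{λ∈Λ} a norm-defining approximate order unit for 𝓐 contained in 𝓔. Then every positive bounded linear functional φ on E extends to a positive bounded linear functional φ̃ on A with φ̃|_E = φ and ‖φ̃‖ = ‖φ‖. -/
open scoped ComplexOrder

open CFC

section CStarAlgebra

variable {A : Type*} [NonUnitalCStarAlgebra A] [PartialOrder A] [StarOrderedRing A]

/-- A self-adjoint element lying between `-1` and `1` is a contraction. -/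
lemma norm_le_one_of_neg_one_le_of_le_one {B : Type*} [CStarAlgebra B] [PartialOrder B]
    [StarOrderedRing B] {x : B} (hx : IsSelfAdjoint x) (h₁ : -1 ≤ x) (h₂ : x ≤ 1) :
    ‖x‖ ≤ 1 := by
  nontriviality B
  rcases CStarAlgebra.norm_or_neg_norm_mem_spectrum hx with h | h
  · exact (le_algebraMap_iff_spectrum_le (R := ℝ) (r := 1)).mp (by simpa using h₂) _ h
  · have := (algebraMap_le_iff_le_spectrum (R := ℝ) (r := -1)).mp (by simpa using h₁) _ h
    linarith

/-- The difference of two positive contractions is a contraction. -/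
lemma norm_sub_le_one_of_nonneg {a b : A} (ha : 0 ≤ a) (hb : 0 ≤ b) (ha₁ : ‖a‖ ≤ 1)
    (hb₁ : ‖b‖ ≤ 1) : ‖a - b‖ ≤ 1 := by
  obtain ⟨ha₀, ha₂⟩ := CStarAlgebra.inr_mem_Icc_iff_norm_le.mpr ⟨ha, ha₁⟩
  obtain ⟨hb₀, hb₂⟩ := CStarAlgebra.inr_mem_Icc_iff_norm_le.mpr ⟨hb, hb₁⟩
  rw [← Unitization.norm_inr (𝕜 := ℂ), Unitization.inr_sub]
  refine norm_le_one_of_neg_one_le_of_le_one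
    ((IsSelfAdjoint.of_nonneg ha₀).sub (.of_nonneg hb₀)) ?_ ?_
  · simpa using sub_le_sub ha₀ hb₂
  · simpa using sub_le_sub ha₂ hb₀

/-- Compressing a positive `2 × 2` matrix by the vector `(1, -1)`. -/
lemma le_of_matrix_eq_star_mul_self {x y : A} (hx : IsSelfAdjoint x)
    {z : Matrix (Fin 2) (Fin 2) A} (hz : !![y, x; star x, y] = star z * z) : x ≤ y := by
  have h00 := congrFun₂ hz 0 0
  have h01 := congrFun₂ hz 0 1
  have h10 := congrFun₂ hz 1 0
  have h11 := congrFun₂ hz 1 1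
  simp only [Matrix.of_apply, Matrix.cons_val', Matrix.cons_val_zero, Matrix.cons_val_one,
    Matrix.cons_val_fin_one, Matrix.mul_apply, Fin.sum_univ_two, Matrix.star_apply,
    hx.star_eq] at h00 h01 h10 h11
  have key : (2 : ℝ) • (y - x) = star (z 0 0 - z 0 1) * (z 0 0 - z 0 1) +
      star (z 1 0 - z 1 1) * (z 1 0 - z 1 1) := by
    calc (2 : ℝ) • (y - x) = y - x - x + y := by module
      _ = _ := by
        nth_rw 1 [h00]
        nth_rw 1 [h01]
        nth_rw 1 [h10]
        nth_rw 1 [h11]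
        simp only [star_sub, mul_sub, sub_mul]
        abel
  have h : 0 ≤ (2 : ℝ) • (y - x) :=
    key ▸ add_nonneg (star_mul_self_nonneg _) (star_mul_self_nonneg _)
  rw [← sub_nonneg]
  simpa [smul_smul] using smul_nonneg (by norm_num : (0 : ℝ) ≤ 2⁻¹) h

/-- The matrix with all entries equal to a positive element is positive. -/
lemma exists_matrix_eq_star_mul_self {a : A} (ha : 0 ≤ a) :
    ∃ z : Matrix (Fin 2) (Fin 2) A, !![a, a; a, a] = star z * z := by
  refine ⟨!![sqrt a, sqrt a; 0, 0], ?_⟩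
  have h : star (sqrt a) = sqrt a := (IsSelfAdjoint.of_nonneg (sqrt_nonneg a)).star_eq
  ext i j
  fin_cases i <;> fin_cases j <;>
    simp [Matrix.mul_apply, Fin.sum_univ_two, Matrix.star_apply, h, sqrt_mul_sqrt_self a ha]

/-- The norm of `𝓐` is the matrix order norm determined by the family `e`. -/
def IsNormDefining {Λ : Type*} (𝓐 : Submodule ℂ A) (e : Λ → A) : Prop :=
  ∀ x ∈ 𝓐, ‖x‖ = sInf {t : ℝ | 0 ≤ t ∧ ∃ l : Λ, ∃ z : Matrix (Fin 2) (Fin 2) A,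
    !![(t : ℂ) • e l, x; star x, (t : ℂ) • e l] = star z * z}

namespace IsNormDefining

variable {Λ : Type*} {E 𝓐 : Submodule ℂ A} {e : Λ → A}

lemma norm_le_one (h : IsNormDefining 𝓐 e) {l : Λ} (hl : e l ∈ 𝓐) (hpos : 0 ≤ e l) :
    ‖e l‖ ≤ 1 := by
  rw [h _ hl]
  refine csInf_le ⟨0, fun t ht => ht.1⟩ ⟨zero_le_one, l, ?_⟩
  simpa [(IsSelfAdjoint.of_nonneg hpos).star_eq] using exists_matrix_eq_star_mul_self hpos

lemma exists_le_smul [Nonempty Λ] (h : IsNormDefining 𝓐 e) {x : A} (hx : x ∈ 𝓐)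
    (hsa : IsSelfAdjoint x) {r : ℝ} (hr : ‖x‖ < r) :
    ∃ l, ∃ t : ℝ, 0 ≤ t ∧ t < r ∧ x ≤ (t : ℂ) • e l := by
  have hxS := h x hx
  set S := {t : ℝ | 0 ≤ t ∧ ∃ l : Λ, ∃ z : Matrix (Fin 2) (Fin 2) A,
    !![(t : ℂ) • e l, x; star x, (t : ℂ) • e l] = star z * z} with hS
  have hne : S.Nonempty := by
    by_contra hempty
    rw [Set.not_nonempty_iff_eq_empty] at hempty
    have hx0 : x = 0 := by simpa [hempty] using hxS
    have : (0 : ℝ) ∈ S := by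
      refine ⟨le_rfl, Classical.arbitrary Λ, 0, ?_⟩
      ext i j
      fin_cases i <;> fin_cases j <;> simp [hx0]
    simp [hempty] at this
  obtain ⟨t, ⟨ht0, l, z, hz⟩, htr⟩ := exists_lt_of_csInf_lt hne (hxS ▸ hr)
  exact ⟨l, t, ht0, htr, le_of_matrix_eq_star_mul_self hsa hz⟩

section Functional

variable [Nonempty Λ] {ψ : A →L[ℂ] ℂ}

lemma im_eq_zero_and_re_le (h : IsNormDefining 𝓐 e) (heE : ∀ l, e l ∈ E)
    (hepos : ∀ l, 0 ≤ e l) (hψ : ∀ x ∈ E, 0 ≤ x → 0 ≤ ψ x) {s : ℝ}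
    (hs : ∀ l, (ψ (e l)).re ≤ s) {x : A} (hxE : x ∈ E) (hx : x ∈ 𝓐) (hsa : IsSelfAdjoint x) :
    (ψ x).im = 0 ∧ (ψ x).re ≤ s * ‖x‖ := by
  have hs0 : 0 ≤ s :=
    (Complex.nonneg_iff.mp (hψ _ (heE (Classical.arbitrary Λ)) (hepos _))).1.trans (hs _)
  have key (r : ℝ) (hr : ‖x‖ < r) : (ψ x).im = 0 ∧ (ψ x).re ≤ s * r := by
    obtain ⟨l, t, ht0, htr, hle⟩ := h.exists_le_smul hx hsa hr
    have h₁ := Complex.nonneg_iff.mp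
      (hψ _ (E.sub_mem (E.smul_mem (t : ℂ) (heE l)) hxE) (sub_nonneg.mpr hle))
    have h₂ := Complex.nonneg_iff.mp (hψ _ (heE l) (hepos l))
    simp only [map_sub, map_smul, smul_eq_mul, Complex.sub_re, Complex.re_ofReal_mul,
      Complex.sub_im, Complex.im_ofReal_mul, ← h₂.2] at h₁
    refine ⟨by linarith [h₁.2], ?_⟩
    nlinarith [mul_le_mul_of_nonneg_left (hs l) ht0, mul_le_mul_of_nonneg_left htr.le hs0]
  refine ⟨(key _ (lt_add_one _)).1, ?_⟩
  refine ge_of_tendsto (x := nhdsWithin ‖x‖ (Set.Ioi ‖x‖)) (f := fun r => s * r) ?_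
    (Filter.eventually_of_mem self_mem_nhdsWithin fun r hr => (key r hr).2)
  exact ((continuous_const_mul s).tendsto _).mono_left nhdsWithin_le_nhds

lemma map_star_of_mem_inf (h : IsNormDefining 𝓐 e) (heE : ∀ l, e l ∈ E)
    (hepos : ∀ l, 0 ≤ e l) (hEstar : ∀ x ∈ E, star x ∈ E) (h𝓐star : ∀ x ∈ 𝓐, star x ∈ 𝓐)
    (hψ : ∀ x ∈ E, 0 ≤ x → 0 ≤ ψ x) {s : ℝ} (hs : ∀ l, (ψ (e l)).re ≤ s)
    {x : A} (hx : x ∈ E ⊓ 𝓐) : ψ (star x) = star (ψ x) := by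
  have hx' : star x ∈ E ⊓ 𝓐 := ⟨hEstar x hx.1, h𝓐star x hx.2⟩
  have h₁ := (E ⊓ 𝓐).add_mem hx hx'
  have h₂ := (E ⊓ 𝓐).smul_mem Complex.I ((E ⊓ 𝓐).sub_mem hx hx')
  have e₁ := (h.im_eq_zero_and_re_le heE hepos hψ hs h₁.1 h₁.2 (.add_star_self x)).1
  have e₂ := (h.im_eq_zero_and_re_le heE hepos hψ hs h₂.1 h₂.2 (by
    simp [isSelfAdjoint_iff, ← smul_neg])).1
  simp only [map_add, map_smul, map_sub, smul_eq_mul, Complex.add_im, Complex.mul_im,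
    Complex.I_re, Complex.I_im, Complex.sub_re, zero_mul, one_mul, zero_add] at e₁ e₂
  apply Complex.ext <;> simp <;> linarith

lemma norm_map_le_of_mem_inf (h : IsNormDefining 𝓐 e) (heE : ∀ l, e l ∈ E)
    (hepos : ∀ l, 0 ≤ e l) (hEstar : ∀ x ∈ E, star x ∈ E) (h𝓐star : ∀ x ∈ 𝓐, star x ∈ 𝓐)
    (hψ : ∀ x ∈ E, 0 ≤ x → 0 ≤ ψ x) {s : ℝ} (hs : ∀ l, (ψ (e l)).re ≤ s)
    {x : A} (hx : x ∈ E ⊓ 𝓐) : ‖ψ x‖ ≤ s * ‖x‖ := by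
  have hs0 : 0 ≤ s :=
    (Complex.nonneg_iff.mp (hψ _ (heE (Classical.arbitrary Λ)) (hepos _))).1.trans (hs _)
  have key (y : A) (hy : y ∈ E ⊓ 𝓐) : (ψ y).re ≤ s * ‖y‖ := by
    have hy' : star y ∈ E ⊓ 𝓐 := ⟨hEstar y hy.1, h𝓐star y hy.2⟩
    have h₁ := (E ⊓ 𝓐).add_mem hy hy'
    have e₁ := (h.im_eq_zero_and_re_le heE hepos hψ hs h₁.1 h₁.2 (.add_star_self y)).2
    rw [map_add, h.map_star_of_mem_inf heE hepos hEstar h𝓐star hψ hs hy] at e₁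
    have e₂ : ‖y + star y‖ ≤ 2 * ‖y‖ := by
      linarith [norm_add_le y (star y), norm_star y]
    simp only [Complex.star_def, Complex.add_re, Complex.conj_re] at e₁
    nlinarith [mul_le_mul_of_nonneg_left e₂ hs0]
  have hkey := key _ ((E ⊓ 𝓐).smul_mem (star (ψ x)) hx)
  have hsq : (star (ψ x) * ψ x).re = ‖ψ x‖ * ‖ψ x‖ := by
    rw [Complex.star_def, mul_comm, Complex.mul_conj, Complex.normSq_eq_norm_sq]
    norm_cast
    ring
  rw [map_smul, smul_eq_mul, hsq, norm_smul, norm_star] at hkey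
  rcases (norm_nonneg (ψ x)).eq_or_lt with h0 | h0
  · rw [← h0]
    positivity
  · refine le_of_mul_le_mul_left ?_ h0
    linarith

end Functional

end IsNormDefining

end CStarAlgebra

/-- The hermitian part of a bounded functional. -/
lemma exists_hermitian_part {A : Type*} [NonUnitalCStarAlgebra A] (ψ : A →L[ℂ] ℂ) :
    ∃ χ : A →L[ℂ] ℂ, (∀ a, χ a = 2⁻¹ * (ψ a + star (ψ (star a)))) ∧ ‖χ‖ ≤ ‖ψ‖ := by
  let f : A →ₗ[ℂ] ℂ :=
    { toFun := fun a => 2⁻¹ * (ψ a + star (ψ (star a)))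
      map_add' := fun a b => by simp only [star_add, map_add]; ring
      map_smul' := fun c a => by
        simp only [star_smul, map_smul, smul_eq_mul, star_mul', star_star, RingHom.id_apply]
        ring }
  have hf (a : A) : ‖f a‖ ≤ ‖ψ‖ * ‖a‖ := by
    have h₁ := ψ.le_opNorm a
    have h₂ := ψ.le_opNorm (star a)
    have h₃ := norm_add_le (ψ a) (star (ψ (star a)))
    rw [norm_star] at h₂ h₃
    simp only [f, LinearMap.coe_mk, AddHom.coe_mk, norm_mul, norm_inv, Complex.norm_ofNat]
    linarith
  exact ⟨f.mkContinuous _ hf, fun a => rfl, f.mkContinuous_norm_le (norm_nonneg ψ) hf⟩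

/-- Under the approximate-order-unit hypotheses, every positive bounded linear
functional `φ` on `E` extends to a positive bounded linear functional `φ̃` on `A` with
`φ̃|_E = φ` and `‖φ̃‖ = ‖φ‖`. -/
theorem stmt13 {A : Type*} [NonUnitalNormedRing A] [StarRing A] [CStarRing A]
    [NormedSpace ℂ A] [StarModule ℂ A] [SMulCommClass ℂ A A] [IsScalarTower ℂ A A]
    [CompleteSpace A] [PartialOrder A] [StarOrderedRing A]
    (E : Submodule ℂ A) (hEclosed : IsClosed (E : Set A)) (hEstar : ∀ x ∈ E, star x ∈ E)
    (𝓐 : Submodule ℂ A) (h𝓐dense : Dense (𝓐 : Set A)) (h𝓐star : ∀ x ∈ 𝓐, star x ∈ 𝓐)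
    (h𝓔dense : (E : Set A) ⊆ closure ((E ⊓ 𝓐 : Submodule ℂ A) : Set A))
    {Λ : Type*} [Nonempty Λ] [Preorder Λ] [IsDirected Λ (· ≤ ·)]
    (e : Λ → A) (heE : ∀ l, e l ∈ E) (he𝓐 : ∀ l, e l ∈ 𝓐)
    (hepos : ∀ l, 0 ≤ e l) (hemono : Monotone e)
    (hnorm : ∀ x ∈ 𝓐, ‖x‖ = sInf {t : ℝ | 0 ≤ t ∧ ∃ l : Λ,
      ∃ z : Matrix (Fin 2) (Fin 2) A,
        !![(t : ℂ) • e l, x; star x, (t : ℂ) • e l] = star z * z})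
    (φ : E →L[ℂ] ℂ) (hφpos : ∀ x : E, 0 ≤ (x : A) → 0 ≤ φ x) :
    ∃ φext : A →L[ℂ] ℂ, (∀ a : A, 0 ≤ a → 0 ≤ φext a) ∧
      (∀ x : E, φext (x : A) = φ x) ∧ ‖φext‖ = ‖φ‖ := by
  let _ : NonUnitalCStarAlgebra A := {}
  have hN : IsNormDefining 𝓐 e := hnorm
  obtain ⟨ψ, hψφ, hψn⟩ := exists_extension_norm_eq E φ
  have hψ : ∀ x ∈ E, 0 ≤ x → 0 ≤ ψ x := fun x hx h0 => hψφ ⟨x, hx⟩ ▸ hφpos ⟨x, hx⟩ h0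
  have he1 (l : Λ) : ‖e l‖ ≤ 1 := hN.norm_le_one (he𝓐 l) (hepos l)
  have hbound {s : ℝ} (hs : ∀ l, (ψ (e l)).re ≤ s) : ‖φ‖ ≤ s := by
    have hs0 : 0 ≤ s :=
      (Complex.nonneg_iff.mp (hψ _ (heE (Classical.arbitrary Λ)) (hepos _))).1.trans (hs _)
    refine φ.opNorm_le_bound hs0 fun x => ?_
    have hcl : IsClosed {y : A | ‖ψ y‖ ≤ s * ‖y‖} :=
      isClosed_le (by fun_prop) (by fun_prop)
    rw [← hψφ x]
    exact closure_minimal (fun y hy =>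
      hN.norm_map_le_of_mem_inf heE hepos hEstar h𝓐star hψ hs hy) hcl (h𝓔dense x.2)
  have hre_le (a : A) : (ψ a).re ≤ ‖φ‖ * ‖a‖ :=
    (Complex.re_le_norm _).trans (hψn ▸ ψ.le_opNorm a)
  have hs : ∀ l, (ψ (e l)).re ≤ ‖φ‖ := fun l =>
    (hre_le _).trans (mul_le_of_le_one_right (norm_nonneg φ) (he1 l))
  have hherm : ∀ x ∈ E, ψ (star x) = star (ψ x) := by
    have hcl : IsClosed {y : A | ψ (star y) = star (ψ y)} :=
      isClosed_eq (by fun_prop) (by fun_prop)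
    exact fun x hx => closure_minimal (fun y hy =>
      hN.map_star_of_mem_inf heE hepos hEstar h𝓐star hψ hs hy) hcl (h𝓔dense hx)
  have hre1 (a : A) (ha : 0 ≤ a) (ha1 : ‖a‖ ≤ 1) : 0 ≤ (ψ a).re := by
    have := hbound (s := ‖φ‖ + (ψ a).re) fun l => by
      have h₁ := hre_le (e l - a)
      have h₂ := mul_le_of_le_one_right (norm_nonneg φ)
        (norm_sub_le_one_of_nonneg (hepos l) ha (he1 l) ha1)
      rw [map_sub, Complex.sub_re] at h₁
      linarith
    linarith
  have hre (a : A) (ha : 0 ≤ a) : 0 ≤ (ψ a).re := by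
    rcases eq_or_ne a 0 with rfl | hne
    · simp
    have hpos : 0 < ‖a‖⁻¹ := inv_pos.mpr (norm_pos_iff.mpr hne)
    have h₁ := hre1 (((‖a‖⁻¹ : ℝ) : ℂ) • a)
      (smul_nonneg (Complex.zero_le_real.mpr hpos.le) ha)
      (by simp [norm_smul, hne])
    rw [map_smul, smul_eq_mul, Complex.re_ofReal_mul] at h₁
    exact nonneg_of_mul_nonneg_right h₁ hpos
  obtain ⟨χ, hχ, hχn⟩ := exists_hermitian_part ψ
  have hχφ (x : E) : χ (x : A) = φ x := by
    rw [hχ, hherm _ x.2, star_star, hψφ]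
    ring
  refine ⟨χ, fun a ha => ?_, hχφ, le_antisymm (hψn ▸ hχn) ?_⟩
  · rw [hχ, (IsSelfAdjoint.of_nonneg ha).star_eq, Complex.star_def, Complex.add_conj]
    have h₁ := hre a ha
    have h₂ : (2⁻¹ * ((2 * (ψ a).re : ℝ) : ℂ)) = ((ψ a).re : ℂ) := by
      push_cast
      ring
    rw [h₂]
    exact Complex.zero_le_real.mpr h₁
  · refine φ.opNorm_le_bound (norm_nonneg _) fun x => ?_
    rw [← hχφ x]
    exact χ.le_opNorm _
end

section
/- Let A be a complex C*-algebra, E ⊆ A a closed *-subspace, 𝓐 ⊆ A a dense *-subspace with 𝓔 := E ∩ 𝓐 dense in E, and (e_λ)_{λ∈Λ} a norm-defining approximate order unit for 𝓐 contained in 𝓔. Then every pure state φ on E extends to a pure state φ̃ on A; that is, there is a state φ̃ on A with φ̃|_E = φ which is an extreme point of the set of states of A. -/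
open scoped ComplexOrder

section Positivity

open Complex

variable {B : Type*} [CStarAlgebra B]

/-- A contractive unital functional takes real values on selfadjoint elements. -/
lemma im_map_eq_zero_of_isSelfAdjoint (g : B →L[ℂ] ℂ) (hg : ‖g‖ ≤ 1) (h1 : g 1 = 1)
    {a : B} (ha : IsSelfAdjoint a) : (g a).im = 0 := by
  have key (n : ℝ) : ((g a).im + n) ^ 2 ≤ ‖a‖ ^ 2 + n ^ 2 * ‖(1 : B)‖ := by
    set x : B := a + ((n : ℂ) * I) • (1 : B) with hx
    have hstar : star x * x = a * a + ((n : ℂ) ^ 2) • (1 : B) := by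
      have hs : star x = a - ((n : ℂ) * I) • (1 : B) := by
        simp [hx, ha.star_eq, sub_eq_add_neg]
      rw [hs, hx, sub_mul, mul_add, mul_add]
      simp only [mul_smul_comm, smul_mul_assoc, mul_one, one_mul, smul_smul]
      have : (n : ℂ) * I * (n * I) = -(n : ℂ) ^ 2 := by
        linear_combination (n : ℂ) ^ 2 * I_sq
      rw [this, neg_smul]
      abel
    have hnorm : ‖x‖ * ‖x‖ ≤ ‖a‖ ^ 2 + n ^ 2 * ‖(1 : B)‖ := by
      rw [← CStarRing.norm_star_mul_self, hstar]
      refine (norm_add_le _ _).trans (add_le_add ?_ ?_)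
      · exact (norm_mul_le _ _).trans_eq (sq _).symm
      · rw [norm_smul]
        simp
    have hgx : (g x).im = (g a).im + n := by simp [hx, h1]
    have hle : |(g x).im| ≤ ‖x‖ :=
      (abs_im_le_norm _).trans ((g.le_opNorm x).trans (mul_le_of_le_one_left (norm_nonneg _) hg))
    rw [← hgx, ← sq_abs]
    nlinarith [abs_nonneg (g x).im]
  have hone : ‖(1 : B)‖ = 1 := by
    have : Nontrivial B := ⟨1, 0, fun h ↦ by simp [h] at h1⟩
    exact CStarRing.norm_one
  rw [hone] at key
  by_contra h
  have hpos : 0 < (g a).im ^ 2 := by positivity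
  have := key ((‖a‖ ^ 2 + 1) / (2 * (g a).im))
  have h2 : 2 * (g a).im * ((‖a‖ ^ 2 + 1) / (2 * (g a).im)) = ‖a‖ ^ 2 + 1 := by
    field_simp
  nlinarith

variable [PartialOrder B] [StarOrderedRing B]

/-- A contractive unital functional on a unital C⋆-algebra is positive. -/
lemma map_nonneg_of_norm_le_one_of_map_one (g : B →L[ℂ] ℂ) (hg : ‖g‖ ≤ 1) (h1 : g 1 = 1)
    {a : B} (ha : 0 ≤ a) : 0 ≤ g a := by
  rw [Complex.nonneg_iff]
  refine ⟨?_, (im_map_eq_zero_of_isSelfAdjoint g hg h1 (.of_nonneg ha)).symm⟩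
  set r := ‖a‖
  have har : a ≤ algebraMap ℝ B r :=
    (CStarAlgebra.norm_le_iff_le_algebraMap a (norm_nonneg a) ha).1 le_rfl
  have hnorm : ‖algebraMap ℝ B r - a‖ ≤ r :=
    (CStarAlgebra.norm_le_iff_le_algebraMap _ (norm_nonneg a) (sub_nonneg.2 har)).2
      (sub_le_self _ ha)
  have hval : g (algebraMap ℝ B r - a) = r - g a := by
    rw [map_sub, Algebra.algebraMap_eq_smul_one, ← Complex.coe_smul, map_smul, h1]
    simp
  have hle : (r : ℝ) - (g a).re ≤ r := by
    calc r - (g a).re = (g (algebraMap ℝ B r - a)).re := by simp [hval]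
      _ ≤ ‖g (algebraMap ℝ B r - a)‖ := re_le_norm _
      _ ≤ ‖algebraMap ℝ B r - a‖ :=
        (g.le_opNorm _).trans (mul_le_of_le_one_left (norm_nonneg _) hg)
      _ ≤ r := hnorm
  linarith

lemma norm_two_smul_sub_one_le {a : B} (ha : 0 ≤ a) (ha1 : ‖a‖ ≤ 1) :
    ‖(2 : ℂ) • a - 1‖ ≤ 1 := by
  have hle : a ≤ 1 := (CStarAlgebra.norm_le_one_iff_of_nonneg a ha).1 ha1
  have hsa : star ((2 : ℂ) • a - 1) = (2 : ℂ) • a - 1 := by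
    simp [(IsSelfAdjoint.of_nonneg ha).star_eq]
  have hprod : 0 ≤ a * (1 - a) :=
    Commute.mul_nonneg ha (sub_nonneg.2 hle) ((Commute.one_right a).sub_right (Commute.refl a))
  have hsq : star ((2 : ℂ) • a - 1) * ((2 : ℂ) • a - 1) ≤ 1 := by
    rw [hsa, ← sub_nonneg]
    convert add_nonneg (add_nonneg hprod hprod) (add_nonneg hprod hprod) using 1
    simp only [two_smul]
    noncomm_ring
  have hn := (CStarAlgebra.norm_le_one_iff_of_nonneg _ (star_mul_self_nonneg _)).2 hsq
  rw [CStarRing.norm_star_mul_self] at hn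
  nlinarith [norm_nonneg ((2 : ℂ) • a - 1)]

end Positivity

section Extension

/-- Every bounded functional extends to the unitization with the same norm. -/
lemma exists_unitization_extension_norm_eq {A : Type*} [NonUnitalCStarAlgebra A]
    (ψ : A →L[ℂ] ℂ) :
    ∃ g : Unitization ℂ A →L[ℂ] ℂ, (∀ a : A, g a = ψ a) ∧ ‖g‖ = ‖ψ‖ := by
  let ι : A →ₗᵢ[ℂ] Unitization ℂ A :=
    ⟨Unitization.inrHom ℂ ℂ A, Unitization.norm_inr⟩
  obtain ⟨g, hg, hn⟩ := exists_extension_norm_eq ι.toLinearMap.range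
    (ψ.comp (ι.equivRange.symm.toContinuousLinearEquiv : _ →L[ℂ] A))
  refine ⟨g, fun a ↦ ?_, ?_⟩
  · have h : g (ι a) = ψ a := by simpa using hg (ι.equivRange a)
    exact h
  · rw [hn]
    exact ContinuousLinearMap.opNorm_comp_linearIsometryEquiv ψ ι.equivRange.symm

/-- A contractive functional that is almost norming on the positive unit ball is positive. -/
lemma map_nonneg_of_almost_norming {A : Type*} [NonUnitalCStarAlgebra A] [PartialOrder A]
    [StarOrderedRing A] (ψ : A →L[ℂ] ℂ) (hψ : ‖ψ‖ ≤ 1)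
    (happrox : ∀ ε > 0, ∃ b : A, 0 ≤ b ∧ ‖b‖ ≤ 1 ∧ 1 - ε < (ψ b).re) {a : A} (ha : 0 ≤ a) :
    0 ≤ ψ a := by
  obtain ⟨g, hg, hn⟩ := exists_unitization_extension_norm_eq ψ
  rw [← hn] at hψ
  have hbound (x : Unitization ℂ A) (hx : ‖x‖ ≤ 1) : ‖g x‖ ≤ 1 :=
    (g.le_opNorm x).trans (mul_le_one₀ hψ (norm_nonneg _) hx)
  have hone_norm : ‖g 1‖ ≤ 1 := hbound 1 CStarRing.norm_one.le
  have hre : 1 ≤ (g 1).re := by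
    refine le_of_forall_pos_sub_le fun ε hε ↦ ?_
    obtain ⟨b, hb, hb1, hlt⟩ := happrox (ε / 2) (by positivity)
    have hle := hbound _ (norm_two_smul_sub_one_le (Unitization.inr_nonneg_iff.2 hb)
      ((Unitization.norm_inr (𝕜 := ℂ) b).trans_le hb1))
    have hre := (Complex.re_le_norm _).trans hle
    simp only [map_sub, map_smul, hg, smul_eq_mul, Complex.sub_re, Complex.mul_re,
      Complex.re_ofNat, Complex.im_ofNat] at hre
    linarith
  have h1 : g 1 = 1 := by
    have hsq := Complex.sq_norm (g 1)
    rw [Complex.normSq_apply] at hsq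
    have : (g 1).im = 0 := by nlinarith [norm_nonneg (g 1)]
    apply Complex.ext
    · exact le_antisymm ((Complex.re_le_norm _).trans hone_norm) hre
    · simpa using this
  rw [← hg]
  exact map_nonneg_of_norm_le_one_of_map_one g hψ h1 (Unitization.inr_nonneg_iff.2 ha)

/-- The contractive extensions of a contractive functional on a subspace have an extreme point. -/
lemma exists_mem_extremePoints_extension {V : Type*} [NormedAddCommGroup V] [NormedSpace ℂ V]
    (E : Submodule ℂ V) (φ : E →L[ℂ] ℂ) (hφ : ‖φ‖ ≤ 1) :
    (Set.extremePoints ℝ {ψ : V →L[ℂ] ℂ | ‖ψ‖ ≤ 1 ∧ ∀ x : E, ψ x = φ x}).Nonempty := by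
  have : LocallyConvexSpace ℝ (WeakDual ℂ V) :=
    inferInstanceAs (LocallyConvexSpace ℝ (WeakBilin (topDualPairing ℂ V)))
  let S : Set (WeakDual ℂ V) := WeakDual.toStrongDual ⁻¹' Metric.closedBall 0 1 ∩
    ⋂ x : E, {ψ | ψ x = φ x}
  have hS : IsCompact S := (WeakDual.isCompact_closedBall 0 1).inter_right <|
    isClosed_iInter fun x ↦ isClosed_eq (WeakDual.eval_continuous _) continuous_const
  obtain ⟨g, hg, hn⟩ := exists_extension_norm_eq E φ
  have hne : S.Nonempty :=
    ⟨StrongDual.toWeakDual g, by simpa [hn] using hφ, Set.mem_iInter.2 hg⟩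
  obtain ⟨ψ, hψ⟩ := hS.extremePoints_nonempty hne
  have hSeq : S = {ψ : V →L[ℂ] ℂ | ‖ψ‖ ≤ 1 ∧ ∀ x : E, ψ x = φ x} := by
    ext ψ
    simp only [S, Set.mem_inter_iff, Set.mem_preimage, mem_closedBall_zero_iff, Set.mem_iInter]
    rfl
  rw [hSeq] at hψ
  exact ⟨ψ, hψ⟩

lemma norm_smul_add_smul_le {V : Type*} [SeminormedAddCommGroup V] [NormedSpace ℂ V] {a b : ℝ}
    (ha : 0 ≤ a) (hb : 0 ≤ b) (f g : V →L[ℂ] ℂ) : ‖a • f + b • g‖ ≤ a * ‖f‖ + b * ‖g‖ := by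
  refine (norm_add_le _ _).trans_eq ?_
  rw [norm_smul, norm_smul, Real.norm_of_nonneg ha, Real.norm_of_nonneg hb]

end Extension

section ApproximateOrderUnit

variable {A : Type*} [NonUnitalCStarAlgebra A] [PartialOrder A] [StarOrderedRing A]

/-- Compressing a positive `2 × 2` matrix to the vector `(1, -1)` gives a positive element. -/
lemma nonneg_of_matrix_eq_star_mul_self {a x : A} {z : Matrix (Fin 2) (Fin 2) A}
    (hz : !![a, x; star x, a] = star z * z) : 0 ≤ a + a - (x + star x) := by
  have h (i j : Fin 2) := congrFun (congrFun hz i) j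
  have h00 := h 0 0
  have h01 := h 0 1
  have h10 := h 1 0
  have h11 := h 1 1
  simp only [Matrix.mul_apply, Matrix.star_apply, Fin.sum_univ_two, Matrix.of_apply,
    Matrix.cons_val_zero, Matrix.cons_val_one, Matrix.cons_val', Matrix.cons_val_fin_one]
    at h00 h01 h10 h11
  have heq : a + a - (x + star x) = star (z 0 0 - z 0 1) * (z 0 0 - z 0 1) +
      star (z 1 0 - z 1 1) * (z 1 0 - z 1 1) := by
    calc a + a - (x + star x) = _ + _ - (_ + _) :=
          congrArg₂ (· - ·) (congrArg₂ (· + ·) h00 h11) (congrArg₂ (· + ·) h01 h10)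
      _ = _ := by
        simp only [star_sub]
        noncomm_ring
  rw [heq]
  exact add_nonneg (star_mul_self_nonneg _) (star_mul_self_nonneg _)

variable {𝓐 : Submodule ℂ A} {Λ : Type*} {e : Λ → A}

/-- Members of a norm-defining approximate order unit are contractions. -/
lemma norm_le_one_of_norm_defining (he𝓐 : ∀ l, e l ∈ 𝓐) (hepos : ∀ l, 0 ≤ e l)
    (hnorm : ∀ x ∈ 𝓐, ‖x‖ = sInf {t : ℝ | 0 ≤ t ∧ ∃ l : Λ,
      ∃ z : Matrix (Fin 2) (Fin 2) A,
        !![(t : ℂ) • e l, x; star x, (t : ℂ) • e l] = star z * z}) (l : Λ) :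
    ‖e l‖ ≤ 1 := by
  rw [hnorm _ (he𝓐 l)]
  refine csInf_le ⟨0, fun t ht ↦ ht.1⟩ ⟨zero_le_one, l, ?_⟩
  obtain ⟨s, hs⟩ := CStarAlgebra.nonneg_iff_eq_star_mul_self.1 (hepos l)
  refine ⟨!![s, s; 0, 0], ?_⟩
  rw [(IsSelfAdjoint.of_nonneg (hepos l)).star_eq]
  ext i j
  fin_cases i <;> fin_cases j <;> simp [Matrix.mul_apply, Matrix.star_apply, hs]

lemma exists_nonneg_of_norm_lt [Nonempty Λ]
    (hnorm : ∀ x ∈ 𝓐, ‖x‖ = sInf {t : ℝ | 0 ≤ t ∧ ∃ l : Λ,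
      ∃ z : Matrix (Fin 2) (Fin 2) A,
        !![(t : ℂ) • e l, x; star x, (t : ℂ) • e l] = star z * z})
    {x : A} (hx : x ∈ 𝓐) {r : ℝ} (hr : ‖x‖ < r) :
    ∃ t : ℝ, 0 ≤ t ∧ t < r ∧ ∃ l, 0 ≤ (t : ℂ) • e l + (t : ℂ) • e l - (x + star x) := by
  rcases Set.eq_empty_or_nonempty {t : ℝ | 0 ≤ t ∧ ∃ l : Λ,
      ∃ z : Matrix (Fin 2) (Fin 2) A,
        !![(t : ℂ) • e l, x; star x, (t : ℂ) • e l] = star z * z} with hemp | hne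
  · have hx0 : x = 0 := by
      rw [← norm_eq_zero, hnorm x hx, hemp, Real.sInf_empty]
    exact ⟨0, le_rfl, (norm_nonneg x).trans_lt hr, Classical.arbitrary Λ, by simp [hx0]⟩
  · rw [hnorm x hx] at hr
    obtain ⟨t, ⟨ht, l, z, hz⟩, htr⟩ := exists_lt_of_csInf_lt hne hr
    exact ⟨t, ht, htr, l, nonneg_of_matrix_eq_star_mul_self hz⟩

/-- A positive functional on a subspace is hermitian on elements dominated by the approximate
order unit. -/
lemma map_star_eq_conj_of_norm_defining [Nonempty Λ] (E : Submodule ℂ A)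
    (hEstar : ∀ x ∈ E, star x ∈ E) (heE : ∀ l, e l ∈ E) (hepos : ∀ l, 0 ≤ e l)
    (hnorm : ∀ x ∈ 𝓐, ‖x‖ = sInf {t : ℝ | 0 ≤ t ∧ ∃ l : Λ,
      ∃ z : Matrix (Fin 2) (Fin 2) A,
        !![(t : ℂ) • e l, x; star x, (t : ℂ) • e l] = star z * z})
    (φ : E →L[ℂ] ℂ) (hφ : ∀ x : E, 0 ≤ (x : A) → 0 ≤ φ x) (x : E) (hx : (x : A) ∈ 𝓐) :
    φ ⟨star x, hEstar x x.2⟩ = star (φ x) := by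
  have him (y : E) (hy : (y : A) ∈ 𝓐) : (φ y + φ ⟨star y, hEstar y y.2⟩).im = 0 := by
    obtain ⟨t, -, -, l, hl⟩ := exists_nonneg_of_norm_lt hnorm hy (lt_add_one _)
    have h1 := (Complex.nonneg_iff.1 (hφ ((t : ℂ) • ⟨e l, heE l⟩ + (t : ℂ) • ⟨e l, heE l⟩ -
      (y + ⟨star y, hEstar y y.2⟩)) hl)).2
    have h2 := (Complex.nonneg_iff.1 (hφ ⟨e l, heE l⟩ (hepos l))).2
    rw [map_sub, map_add, map_add, map_smul φ (t : ℂ)] at h1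
    simp only [Complex.sub_im, Complex.add_im, smul_eq_mul,
      Complex.im_ofReal_mul, ← h2] at h1 ⊢
    linarith
  have h1 := him x hx
  have h2 := him (Complex.I • x) (𝓐.smul_mem _ hx)
  have hstar : (⟨star ((Complex.I • x : E) : A), hEstar _ (Complex.I • x).2⟩ : E) =
      (-Complex.I) • ⟨star x, hEstar x x.2⟩ := by
    ext
    simp
  rw [hstar, map_smul, map_smul] at h2
  simp at h1 h2
  apply Complex.ext <;> simp <;> linarith

lemma norm_map_le_of_norm_defining [Nonempty Λ] (E : Submodule ℂ A)
    (hEstar : ∀ x ∈ E, star x ∈ E) (heE : ∀ l, e l ∈ E) (hepos : ∀ l, 0 ≤ e l)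
    (hnorm : ∀ x ∈ 𝓐, ‖x‖ = sInf {t : ℝ | 0 ≤ t ∧ ∃ l : Λ,
      ∃ z : Matrix (Fin 2) (Fin 2) A,
        !![(t : ℂ) • e l, x; star x, (t : ℂ) • e l] = star z * z})
    (φ : E →L[ℂ] ℂ) (hφ : ∀ x : E, 0 ≤ (x : A) → 0 ≤ φ x) {c : ℝ} (hc : 0 ≤ c)
    (hec : ∀ l, (φ ⟨e l, heE l⟩).re ≤ c) (x : E) (hx : (x : A) ∈ 𝓐) :
    ‖φ x‖ ≤ c * ‖x‖ := by
  obtain ⟨ζ, hζ, hζx⟩ : ∃ ζ : ℂ, ‖ζ‖ = 1 ∧ φ (ζ • x) = (‖φ x‖ : ℂ) := by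
    obtain ⟨ζ, hζ, h⟩ := RCLike.exists_norm_eq_mul_self (φ x)
    exact ⟨ζ, hζ, by rw [map_smul, smul_eq_mul]; exact h.symm⟩
  have hy : ((ζ • x : E) : A) ∈ 𝓐 := 𝓐.smul_mem _ hx
  have hynorm : ‖((ζ • x : E) : A)‖ = ‖x‖ := by simp [norm_smul, hζ]
  have hbound (r : ℝ) (hr : ‖x‖ < r) : ‖φ x‖ ≤ c * r := by
    obtain ⟨t, ht, htr, l, hl⟩ := exists_nonneg_of_norm_lt hnorm hy (hynorm.trans_lt hr)
    have h1 := (Complex.nonneg_iff.1 (hφ ((t : ℂ) • ⟨e l, heE l⟩ + (t : ℂ) • ⟨e l, heE l⟩ -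
      (ζ • x + ⟨star ((ζ • x : E) : A), hEstar _ (ζ • x).2⟩)) hl)).1
    rw [map_sub, map_add, map_add, map_smul φ (t : ℂ),
      map_star_eq_conj_of_norm_defining E hEstar heE hepos hnorm φ hφ _ hy, hζx] at h1
    simp at h1
    nlinarith [hec l]
  refine le_of_forall_pos_le_add fun ε hε ↦ ?_
  have h := hbound (‖x‖ + ε / (c + 1)) (by simp; positivity)
  have hle : c * (ε / (c + 1)) ≤ ε := by
    rw [mul_div_assoc', div_le_iff₀ (by positivity)]
    nlinarith
  linarith

/-- The norm of a positive functional is attained along a norm-defining approximate order unit. -/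
lemma exists_lt_re_map_of_norm_defining [Nonempty Λ] (E : Submodule ℂ A)
    (hEstar : ∀ x ∈ E, star x ∈ E)
    (h𝓔dense : (E : Set A) ⊆ closure ((E ⊓ 𝓐 : Submodule ℂ A) : Set A))
    (heE : ∀ l, e l ∈ E) (hepos : ∀ l, 0 ≤ e l)
    (hnorm : ∀ x ∈ 𝓐, ‖x‖ = sInf {t : ℝ | 0 ≤ t ∧ ∃ l : Λ,
      ∃ z : Matrix (Fin 2) (Fin 2) A,
        !![(t : ℂ) • e l, x; star x, (t : ℂ) • e l] = star z * z})
    (φ : E →L[ℂ] ℂ) (hφ : ∀ x : E, 0 ≤ (x : A) → 0 ≤ φ x) {c : ℝ} (hc : c < ‖φ‖) :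
    ∃ l, c < (φ ⟨e l, heE l⟩).re := by
  by_contra! hec
  have hc0 : 0 ≤ c :=
    (Complex.nonneg_iff.1 (hφ ⟨e (Classical.arbitrary Λ), heE _⟩ (hepos _))).1.trans (hec _)
  have hdense : Dense {x : E | (x : A) ∈ 𝓐} := by
    intro x
    rw [closure_subtype]
    convert h𝓔dense x.2 using 2
    ext y
    simp [and_comm]
  refine hc.not_ge (φ.opNorm_le_bound hc0 fun x ↦ ?_)
  have hclosed : IsClosed {x : E | ‖φ x‖ ≤ c * ‖x‖} :=
    isClosed_le (by fun_prop) (by fun_prop)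
  exact hclosed.closure_subset_iff.2
    (norm_map_le_of_norm_defining E hEstar heE hepos hnorm φ hφ hc0 hec) (hdense x)

end ApproximateOrderUnit

/-- Under the approximate-order-unit hypotheses, every pure state `φ` on `E`
(extreme point of the set of states on `E`) extends to a pure state `φ̃` on `A`. -/
theorem stmt14 {A : Type*} [NonUnitalNormedRing A] [StarRing A] [CStarRing A]
    [NormedSpace ℂ A] [StarModule ℂ A] [SMulCommClass ℂ A A] [IsScalarTower ℂ A A]
    [CompleteSpace A] [PartialOrder A] [StarOrderedRing A]
    (E : Submodule ℂ A) (hEclosed : IsClosed (E : Set A)) (hEstar : ∀ x ∈ E, star x ∈ E)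
    (𝓐 : Submodule ℂ A) (h𝓐dense : Dense (𝓐 : Set A)) (h𝓐star : ∀ x ∈ 𝓐, star x ∈ 𝓐)
    (h𝓔dense : (E : Set A) ⊆ closure ((E ⊓ 𝓐 : Submodule ℂ A) : Set A))
    {Λ : Type*} [Nonempty Λ] [Preorder Λ] [IsDirected Λ (· ≤ ·)]
    (e : Λ → A) (heE : ∀ l, e l ∈ E) (he𝓐 : ∀ l, e l ∈ 𝓐)
    (hepos : ∀ l, 0 ≤ e l) (hemono : Monotone e)
    (hnorm : ∀ x ∈ 𝓐, ‖x‖ = sInf {t : ℝ | 0 ≤ t ∧ ∃ l : Λ,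
      ∃ z : Matrix (Fin 2) (Fin 2) A,
        !![(t : ℂ) • e l, x; star x, (t : ℂ) • e l] = star z * z})
    (φ : E →L[ℂ] ℂ)
    (hφpure : φ ∈ Set.extremePoints ℝ
      {ψ : E →L[ℂ] ℂ | (∀ x : E, 0 ≤ (x : A) → 0 ≤ ψ x) ∧ ‖ψ‖ = 1}) :
    ∃ φext : A →L[ℂ] ℂ, (∀ x : E, φext (x : A) = φ x) ∧
      φext ∈ Set.extremePoints ℝ
        {ψ : A →L[ℂ] ℂ | (∀ a : A, 0 ≤ a → 0 ≤ ψ a) ∧ ‖ψ‖ = 1} := by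
  let _ : NonUnitalCStarAlgebra A := {}
  obtain ⟨⟨hφpos, hφnorm⟩, hφext⟩ := hφpure
  obtain ⟨ψ, ⟨hψ1, hψE⟩, hψext⟩ := exists_mem_extremePoints_extension E φ hφnorm.le
  have hpos (a : A) (ha : 0 ≤ a) : 0 ≤ ψ a := by
    refine map_nonneg_of_almost_norming ψ hψ1 (fun ε hε ↦ ?_) ha
    obtain ⟨l, hl⟩ := exists_lt_re_map_of_norm_defining E hEstar h𝓔dense heE hepos hnorm φ hφpos
      (c := 1 - ε) (by linarith)
    exact ⟨e l, hepos l, norm_le_one_of_norm_defining he𝓐 hepos hnorm l,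
      by rwa [← hψE ⟨e l, heE l⟩] at hl⟩
  have hrestrict (χ : A →L[ℂ] ℂ) : ‖χ.comp E.subtypeL‖ ≤ ‖χ‖ :=
    ContinuousLinearMap.opNorm_le_bound _ (norm_nonneg _) fun x ↦ χ.le_opNorm x
  have hψres : ψ.comp E.subtypeL = φ := ContinuousLinearMap.ext hψE
  have hψnorm : ‖ψ‖ = 1 := le_antisymm hψ1 (by rw [← hφnorm, ← hψres]; exact hrestrict ψ)
  refine ⟨ψ, hψE, ⟨hpos, hψnorm⟩, ?_⟩
  rintro χ₁ ⟨hχ₁, hn₁⟩ χ₂ ⟨hχ₂, hn₂⟩ hseg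
  obtain ⟨a, b, ha, hb, hab, heq⟩ := hseg
  have hres : a • χ₁.comp E.subtypeL + b • χ₂.comp E.subtypeL = φ := by
    rw [← hψres, ← heq]
    rfl
  have hle₁ := (hrestrict χ₁).trans_eq hn₁
  have hle₂ := (hrestrict χ₂).trans_eq hn₂
  have hsum : 1 ≤ a * ‖χ₁.comp E.subtypeL‖ + b * ‖χ₂.comp E.subtypeL‖ := by
    rw [← hφnorm, ← hres]
    exact norm_smul_add_smul_le ha.le hb.le _ _
  have hnorm₁ : ‖χ₁.comp E.subtypeL‖ = 1 := le_antisymm hle₁ (by nlinarith)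
  have hnorm₂ : ‖χ₂.comp E.subtypeL‖ = 1 := le_antisymm hle₂ (by nlinarith)
  have hmem₁ := hφext ⟨fun x hx ↦ hχ₁ x hx, hnorm₁⟩ ⟨fun x hx ↦ hχ₂ x hx, hnorm₂⟩
    ⟨a, b, ha, hb, hab, hres⟩
  have hmem₂ := hφext ⟨fun x hx ↦ hχ₂ x hx, hnorm₂⟩ ⟨fun x hx ↦ hχ₁ x hx, hnorm₁⟩
    ⟨b, a, hb, ha, by linarith, by rw [add_comm]; exact hres⟩
  exact hψext ⟨hn₁.le, fun x ↦ DFunLike.congr_fun hmem₁ x⟩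
    ⟨hn₂.le, fun x ↦ DFunLike.congr_fun hmem₂ x⟩ ⟨a, b, ha, hb, hab, heq⟩
end

section
/- (Jordan decomposition for subspaces of C*-algebras.) Let A be a complex C*-algebra, E ⊆ A a closed *-subspace, 𝓐 ⊆ A a dense *-subspace with 𝓔 := E ∩ 𝓐 dense in E, and (e_λ)_{λ∈Λ} a norm-defining approximate order unit for 𝓐 contained in 𝓔. Then for every hermitian bounded linear functional φ on E there exist positive bounded linear functionals φ₊ and φ₋ on E such that φ = φ₊ − φ₋ and ‖φ‖ = ‖φ₊‖ + ‖φ₋‖. -/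
open scoped ComplexOrder

section UnitalSelfAdjoint

variable {B : Type*} [CStarAlgebra B] [PartialOrder B] [StarOrderedRing B]

/-- A self-adjoint element lying between `-t` and `t` has norm at most `t`. -/
lemma IsSelfAdjoint.norm_le_of_le_algebraMap [Nontrivial B] {x : B} (hx : IsSelfAdjoint x) {t : ℝ}
    (hle : x ≤ algebraMap ℝ B t) (hge : algebraMap ℝ B (-t) ≤ x) : ‖x‖ ≤ t := by
  rw [le_algebraMap_iff_spectrum_le] at hle
  rw [algebraMap_le_iff_le_spectrum] at hge
  rcases CStarAlgebra.norm_or_neg_norm_mem_spectrum hx with h | h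
  · exact hle _ h
  · linarith [hge _ h]

namespace selfAdjoint

lemma norm_smul_one_add_nonneg (x : selfAdjoint B) : 0 ≤ ‖x‖ • (1 : selfAdjoint B) + x := by
  rw [← Subtype.coe_le_coe]
  simpa [Algebra.algebraMap_eq_smul_one, neg_le_iff_add_nonneg'] using
    x.2.neg_algebraMap_norm_le_self

/-- A positive functional on the self-adjoint part is bounded by its value at `1`. -/
lemma abs_apply_le_of_nonneg (p : selfAdjoint B →ₗ[ℝ] ℝ) (hp : ∀ x, 0 ≤ x → 0 ≤ p x)
    (x : selfAdjoint B) : |p x| ≤ p 1 * ‖x‖ := by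
  have lower (y : selfAdjoint B) : 0 ≤ ‖y‖ * p 1 + p y := by
    simpa using hp _ (norm_smul_one_add_nonneg y)
  have h := lower (-x)
  rw [map_neg, norm_neg] at h
  exact abs_le.2 ⟨by linarith [lower x], by linarith⟩

/-- The cone of pairs `(a, b)` of self-adjoint elements with `-a ≤ b ≤ a`. -/
def absLeCone (B : Type*) [CStarAlgebra B] [PartialOrder B] [StarOrderedRing B] :
    PointedCone ℝ (selfAdjoint B × selfAdjoint B) where
  carrier := {v | 0 ≤ v.1 + v.2 ∧ 0 ≤ v.1 - v.2}
  zero_mem' := by simp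
  add_mem' {v w} hv hw := by
    refine ⟨(add_nonneg hv.1 hw.1).trans_eq ?_, (add_nonneg hv.2 hw.2).trans_eq ?_⟩ <;>
      simp only [Prod.fst_add, Prod.snd_add] <;> abel
  smul_mem' c v hv := by
    have key (x : selfAdjoint B) (hx : 0 ≤ x) : 0 ≤ c • x := by
      rw [← Subtype.coe_le_coe] at hx ⊢
      exact smul_nonneg c.2 hx
    exact ⟨(key _ hv.1).trans_eq (smul_add ..), (key _ hv.2).trans_eq (smul_sub ..)⟩

lemma mem_absLeCone {v : selfAdjoint B × selfAdjoint B} :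
    v ∈ absLeCone B ↔ 0 ≤ v.1 + v.2 ∧ 0 ≤ v.1 - v.2 := Iff.rfl

/-- A functional on the self-adjoint part that is bounded by `N` on a subspace agrees there with a
difference of two positive functionals whose values at `1` add up to `N`. -/
lemma exists_nonneg_sub_nonneg [Nontrivial B] (S : Submodule ℝ (selfAdjoint B))
    (f : selfAdjoint B →ₗ[ℝ] ℝ) {N : ℝ} (hf : ∀ x ∈ S, |f x| ≤ N * ‖x‖) (hN : 0 ≤ N) :
    ∃ p q : selfAdjoint B →ₗ[ℝ] ℝ, (∀ x, 0 ≤ x → 0 ≤ p x) ∧ (∀ x, 0 ≤ x → 0 ≤ q x) ∧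
      (∀ x ∈ S, f x = p x - q x) ∧ p 1 + q 1 = N := by
  obtain ⟨c, hc⟩ := SeparatingDual.exists_eq_one (R := ℝ) (x := (1 : selfAdjoint B))
    fun h ↦ one_ne_zero (α := B) (congrArg Subtype.val h)
  let F : selfAdjoint B × selfAdjoint B →ₗ[ℝ] ℝ := (N • (c : selfAdjoint B →ₗ[ℝ] ℝ)).coprod f
  have F_apply (t : ℝ) (x : selfAdjoint B) : F (t • 1, x) = N * t + f x := by
    simp [F, hc, mul_comm]
  have nonneg : ∀ v : ((Submodule.span ℝ {1}).prod S : Submodule ℝ (selfAdjoint B × selfAdjoint B)),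
      (v : selfAdjoint B × selfAdjoint B) ∈ absLeCone B → 0 ≤ F v := by
    rintro ⟨⟨a, x⟩, ha, hx⟩ hax
    obtain ⟨t, rfl⟩ := Submodule.mem_span_singleton.1 ha
    have hxt : ‖x‖ ≤ t := by
      obtain ⟨h₁, h₂⟩ := mem_absLeCone.1 hax
      simp only [← Subtype.coe_le_coe] at h₁ h₂
      refine x.2.norm_le_of_le_algebraMap ?_ ?_
      · rw [Algebra.algebraMap_eq_smul_one, ← sub_nonneg]
        simpa using h₂
      · rw [Algebra.algebraMap_eq_smul_one, ← sub_nonneg]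
        simpa [add_comm] using h₁
    have h := (abs_le.1 (hf x hx)).1
    have h' : N * ‖x‖ ≤ N * t := mul_le_mul_of_nonneg_left hxt hN
    change 0 ≤ F (t • 1, x)
    rw [F_apply]
    linarith
  have dense : ∀ w, ∃ v : ((Submodule.span ℝ {1}).prod S :
      Submodule ℝ (selfAdjoint B × selfAdjoint B)),
      (v : selfAdjoint B × selfAdjoint B) + w ∈ absLeCone B := by
    rintro ⟨a, b⟩
    refine ⟨⟨((‖a‖ + ‖b‖) • 1, 0), Submodule.smul_mem _ _
      (Submodule.mem_span_singleton_self _), S.zero_mem⟩, mem_absLeCone.2 ⟨?_, ?_⟩⟩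
    · refine (add_nonneg (norm_smul_one_add_nonneg a) (norm_smul_one_add_nonneg b)).trans_eq ?_
      simp only [Prod.fst_add, Prod.snd_add, add_smul, zero_add]
      abel
    · refine (add_nonneg (norm_smul_one_add_nonneg a) (norm_smul_one_add_nonneg (-b))).trans_eq ?_
      simp only [Prod.fst_add, Prod.snd_add, add_smul, zero_add, norm_neg]
      abel
  obtain ⟨g, hgF, hg⟩ := riesz_extension (absLeCone B)
    (F.toPMap ((Submodule.span ℝ {1}).prod S)) nonneg dense
  have g_apply (t : ℝ) {x : selfAdjoint B} (hx : x ∈ S) : g (t • 1, x) = N * t + f x :=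
    (hgF ⟨_, Submodule.smul_mem _ _ (Submodule.mem_span_singleton_self _), hx⟩).trans
      (F_apply t x)
  refine ⟨(1 / 2 : ℝ) • g ∘ₗ LinearMap.id.prod LinearMap.id,
    (1 / 2 : ℝ) • g ∘ₗ LinearMap.id.prod (-LinearMap.id), fun x hx ↦ ?_, fun x hx ↦ ?_,
    fun x hx ↦ ?_, ?_⟩
  · have := hg (x, x) (mem_absLeCone.2 ⟨add_nonneg hx hx, (sub_self x).ge⟩)
    simpa using this
  · have := hg (x, -x) (mem_absLeCone.2 ⟨(add_neg_cancel x).ge, by simpa using add_nonneg hx hx⟩)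
    simpa using this
  · have h := g_apply 0 hx
    have h' : g (x, x) - g (x, -x) = 2 * g (0, x) := by
      rw [← map_sub, ← smul_eq_mul, ← map_smul]
      congr 1
      ext <;> simp [two_smul]
    simp only [zero_smul, mul_zero, zero_add] at h
    change f x = 1 / 2 * g (x, x) - 1 / 2 * g (x, -x)
    linarith
  · have h := g_apply 1 S.zero_mem
    have h' : g (1, 1) + g (1, -1) = 2 * g (1, 0) := by
      rw [← map_add, ← smul_eq_mul, ← map_smul]
      congr 1
      ext <;> simp [two_smul]
    simp only [one_smul, mul_one, map_zero, add_zero] at h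
    change 1 / 2 * g (1, 1) + 1 / 2 * g (1, -1) = N
    linarith

end selfAdjoint

end UnitalSelfAdjoint

section Subspace

variable {A : Type*} [NonUnitalCStarAlgebra A]

/-- The real part of `x : E`, viewed in the unitization of the ambient algebra. -/
noncomputable def Submodule.unitizationRealPart (E : Submodule ℂ A) :
    E →ₗ[ℝ] selfAdjoint (Unitization ℂ A) :=
  realPart ∘ₗ (Unitization.inrHom ℝ ℂ A) ∘ₗ (E.subtype.restrictScalars ℝ)

lemma Submodule.coe_unitizationRealPart_eq (E : Submodule ℂ A) (x : E)
    (hx : IsSelfAdjoint (x : A)) :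
    (E.unitizationRealPart x : Unitization ℂ A) = ((x : A) : Unitization ℂ A) :=
  IsSelfAdjoint.coe_realPart (hx.inr ℂ)

lemma Submodule.norm_unitizationRealPart_le (E : Submodule ℂ A) (x : E) :
    ‖E.unitizationRealPart x‖ ≤ ‖x‖ :=
  (realPart.norm_le _).trans_eq (Unitization.norm_inr (x : A))

variable [PartialOrder A] [StarOrderedRing A]

/-- A positive functional on the self-adjoint part of the unitization of `A` restricts to a
positive functional on a subspace `E` of `A`. -/
lemma exists_extendRCLike_of_nonneg (E : Submodule ℂ A)
    (p : selfAdjoint (Unitization ℂ A) →ₗ[ℝ] ℝ) (hp : ∀ x, 0 ≤ x → 0 ≤ p x) :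
    ∃ ψ : E →L[ℂ] ℂ, (∀ x, (ψ x).re = p (E.unitizationRealPart x)) ∧
      (∀ x : E, 0 ≤ (x : A) → 0 ≤ ψ x) ∧ ‖ψ‖ ≤ p 1 := by
  have hp₁ : 0 ≤ p 1 := hp 1 (by rw [← Subtype.coe_le_coe]; exact zero_le_one)
  let r : StrongDual ℝ E := (p ∘ₗ E.unitizationRealPart).mkContinuous (p 1) fun x ↦
    (selfAdjoint.abs_apply_le_of_nonneg p hp _).trans
      (mul_le_mul_of_nonneg_left (E.norm_unitizationRealPart_le x) hp₁)
  have hr (x : E) : r x = p (E.unitizationRealPart x) := rfl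
  refine ⟨r.extendRCLike, fun x ↦ ?_, fun x hx ↦ ?_, ?_⟩
  · rw [← hr, ← StrongDual.re_extendRCLike_apply (𝕜 := ℂ) r x]
    rfl
  · have hsa : IsSelfAdjoint ((x : A) : Unitization ℂ A) := (IsSelfAdjoint.of_nonneg hx).inr ℂ
    have hI : E.unitizationRealPart (Complex.I • x) = 0 := by
      have : E.unitizationRealPart (Complex.I • x) =
          realPart (Complex.I • ((x : A) : Unitization ℂ A)) := by
        simp [Submodule.unitizationRealPart]
      rw [this, realPart_I_smul, hsa.imaginaryPart, neg_zero]
    rw [StrongDual.extendRCLike_apply, hr, hr]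
    have h : 0 ≤ E.unitizationRealPart x := by
      rw [← Subtype.coe_le_coe, E.coe_unitizationRealPart_eq x (.of_nonneg hx)]
      exact Unitization.inr_nonneg_iff.2 hx
    simpa [hI] using hp _ h
  · rw [StrongDual.norm_extendRCLike]
    exact LinearMap.mkContinuous_norm_le _ hp₁ _

/-- Jordan decomposition of a hermitian bounded functional on a self-adjoint subspace of a
C⋆-algebra. -/
theorem exists_jordan_decomposition (E : Submodule ℂ A) (hE : ∀ x ∈ E, star x ∈ E)
    (φ : E →L[ℂ] ℂ)
    (hφ : ∀ x : E, φ ⟨star (x : A), hE (x : A) x.2⟩ = starRingEnd ℂ (φ x)) :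
    ∃ φp φm : E →L[ℂ] ℂ,
      (∀ x : E, 0 ≤ (x : A) → 0 ≤ φp x) ∧ (∀ x : E, 0 ≤ (x : A) → 0 ≤ φm x) ∧
      φ = φp - φm ∧ ‖φ‖ = ‖φp‖ + ‖φm‖ := by
  obtain ⟨φ', hφ'⟩ := LinearMap.exists_extend (φ : E →ₗ[ℂ] ℂ)
  have hφ'E {a : A} (ha : a ∈ E) : φ' a = φ ⟨a, ha⟩ := LinearMap.congr_fun hφ' ⟨a, ha⟩
  let ι : selfAdjoint (Unitization ℂ A) →ₗ[ℝ] Unitization ℂ A :=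
    (selfAdjoint.submodule ℝ (Unitization ℂ A)).subtype
  let f : selfAdjoint (Unitization ℂ A) →ₗ[ℝ] ℝ :=
    Complex.reLm ∘ₗ φ'.restrictScalars ℝ ∘ₗ Unitization.sndHom ℝ ℂ A ∘ₗ ι
  let S : Submodule ℝ (selfAdjoint (Unitization ℂ A)) :=
    ((E.restrictScalars ℝ).map (Unitization.inrHom ℝ ℂ A)).comap ι
  have hf : ∀ x ∈ S, |f x| ≤ ‖φ‖ * ‖x‖ := by
    rintro x ⟨a, ha, hax⟩
    have hfx : f x = (φ ⟨a, ha⟩).re := by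
      have : f x = (φ' (ι x).snd).re := rfl
      rw [this, ← hax, ← hφ'E ha]
      rfl
    have hx : ‖x‖ = ‖a‖ := by
      rw [← Unitization.norm_inr (𝕜 := ℂ) a]
      exact congrArg norm hax.symm
    rw [hfx, hx]
    exact (Complex.abs_re_le_norm _).trans (φ.le_opNorm _)
  obtain ⟨p, q, hp, hq, hpq, hN⟩ := selfAdjoint.exists_nonneg_sub_nonneg S f hf (norm_nonneg φ)
  obtain ⟨φp, hφp, hφp₀, hφp₁⟩ := exists_extendRCLike_of_nonneg E p hp
  obtain ⟨φm, hφm, hφm₀, hφm₁⟩ := exists_extendRCLike_of_nonneg E q hq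
  have hre (x : E) : (φ x).re = ((φp - φm) x).re := by
    let y : E := (2⁻¹ : ℝ) • (x + ⟨star (x : A), hE x x.2⟩)
    have hy : ((y : A) : Unitization ℂ A) = ι (E.unitizationRealPart x) := by
      refine Eq.trans ?_ (realPart_apply_coe _).symm
      simp [y]
    have hfx : f (E.unitizationRealPart x) = (φ y).re := by
      have : f (E.unitizationRealPart x) = (φ' (ι (E.unitizationRealPart x)).snd).re := rfl
      rw [this, ← hy, Unitization.snd_inr, hφ'E y.2]
    have hφy : (φ y).re = (φ x).re := by
      have : φ y = (2⁻¹ : ℝ) • (φ x + starRingEnd ℂ (φ x)) := by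
        rw [← hφ x, ← map_add]
        exact (φ : E →ₗ[ℂ] ℂ).map_smul_of_tower _ _
      rw [this]
      simp only [Complex.smul_re, Complex.add_re, Complex.conj_re, smul_eq_mul]
      ring
    rw [← hφy, ← hfx, hpq _ ⟨y, y.2, hy⟩, ← hφp, ← hφm]
    rfl
  have hsub : φ = φp - φm := by
    ext x
    refine Complex.ext (hre x) ?_
    have h := hre (Complex.I • x)
    simp only [map_smul, smul_eq_mul, Complex.I_mul_re, neg_inj] at h
    exact h
  refine ⟨φp, φm, hφp₀, hφm₀, hsub, le_antisymm ?_ (by linarith)⟩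
  exact (congrArg norm hsub).trans_le (norm_sub_le φp φm)

end Subspace

/-- Jordan decomposition: Under the approximate-order-unit hypotheses, every
hermitian bounded linear functional `φ` on `E` can be written as `φ = φ₊ - φ₋` with `φ₊, φ₋`
positive bounded linear functionals on `E` and `‖φ‖ = ‖φ₊‖ + ‖φ₋‖`. -/
theorem stmt15 {A : Type*} [NonUnitalNormedRing A] [StarRing A] [CStarRing A]
    [NormedSpace ℂ A] [StarModule ℂ A] [SMulCommClass ℂ A A] [IsScalarTower ℂ A A]
    [CompleteSpace A] [PartialOrder A] [StarOrderedRing A]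
    (E : Submodule ℂ A) (hEclosed : IsClosed (E : Set A)) (hEstar : ∀ x ∈ E, star x ∈ E)
    (𝓐 : Submodule ℂ A) (h𝓐dense : Dense (𝓐 : Set A)) (h𝓐star : ∀ x ∈ 𝓐, star x ∈ 𝓐)
    (h𝓔dense : (E : Set A) ⊆ closure ((E ⊓ 𝓐 : Submodule ℂ A) : Set A))
    {Λ : Type*} [Nonempty Λ] [Preorder Λ] [IsDirected Λ (· ≤ ·)]
    (e : Λ → A) (heE : ∀ l, e l ∈ E) (he𝓐 : ∀ l, e l ∈ 𝓐)
    (hepos : ∀ l, 0 ≤ e l) (hemono : Monotone e)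
    (hnorm : ∀ x ∈ 𝓐, ‖x‖ = sInf {t : ℝ | 0 ≤ t ∧ ∃ l : Λ,
      ∃ z : Matrix (Fin 2) (Fin 2) A,
        !![(t : ℂ) • e l, x; star x, (t : ℂ) • e l] = star z * z})
    (φ : E →L[ℂ] ℂ)
    (hφherm : ∀ x : E, φ ⟨star (x : A), hEstar (x : A) x.2⟩ = starRingEnd ℂ (φ x)) :
    ∃ φp φm : E →L[ℂ] ℂ,
      (∀ x : E, 0 ≤ (x : A) → 0 ≤ φp x) ∧ (∀ x : E, 0 ≤ (x : A) → 0 ≤ φm x) ∧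
      φ = φp - φm ∧ ‖φ‖ = ‖φp‖ + ‖φm‖ := by
  let _ : NonUnitalCStarAlgebra A := { }
  exact exists_jordan_decomposition E hEstar φ hφherm
end

section
/- Let p, N, N' be natural numbers and, for a natural number M, let 𝓔_{p,M} denote the subspace of p×p complex matrices B with B i j = 0 whenever the distance |i − j| between the indices exceeds M (band matrices of band width M). Then the ℂ-linear span of the set of products { C * D : C ∈ 𝓔_{p,N}, D ∈ 𝓔_{p,N'} } equals 𝓔_{p,N+N'}. -/
/-- Two indices at distance at most `N + N'` have an index between them at distance at most `N`
from the first and at most `N'` from the second. -/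
lemma exists_index_between {p N N' : ℕ} (i j : Fin p)
    (h : |(i : ℤ) - (j : ℤ)| ≤ (N : ℤ) + (N' : ℤ)) :
    ∃ k : Fin p, |(i : ℤ) - (k : ℤ)| ≤ N ∧ |(k : ℤ) - (j : ℤ)| ≤ N' := by
  have hi := i.isLt
  have hj := j.isLt
  rw [abs_le] at h
  rcases le_total (i : ℕ) (j : ℕ) with hij | hij
  · refine ⟨⟨min (i + N) j, by omega⟩, ?_, ?_⟩ <;> rw [abs_le] <;> dsimp only <;> omega
  · refine ⟨⟨max (i - N) j, by omega⟩, ?_, ?_⟩ <;> rw [abs_le] <;> dsimp only <;> omega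

/-- A matrix unit supported within the band of width `M` is a band matrix of width `M`. -/
lemma single_apply_eq_zero_of_lt_abs_sub {p M : ℕ} {a b : Fin p} (c : ℂ)
    (h : |(a : ℤ) - (b : ℤ)| ≤ M) (i j : Fin p) (hij : (M : ℤ) < |(i : ℤ) - (j : ℤ)|) :
    Matrix.single a b c i j = 0 := by
  refine Matrix.single_apply_of_ne _ _ _ _ _ ?_
  rintro ⟨rfl, rfl⟩
  exact absurd h (not_le.mpr hij)

/-- The product of band matrices of widths `N` and `N'` is a band matrix of width `N + N'`. -/
lemma mul_apply_eq_zero_of_add_lt_abs_sub {p N N' : ℕ} {C D : Matrix (Fin p) (Fin p) ℂ}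
    (hC : ∀ i j : Fin p, (N : ℤ) < |(i : ℤ) - (j : ℤ)| → C i j = 0)
    (hD : ∀ i j : Fin p, (N' : ℤ) < |(i : ℤ) - (j : ℤ)| → D i j = 0)
    (i j : Fin p) (hij : (N : ℤ) + (N' : ℤ) < |(i : ℤ) - (j : ℤ)|) :
    (C * D) i j = 0 := by
  rw [Matrix.mul_apply]
  refine Finset.sum_eq_zero fun k _ => ?_
  by_cases hk : (N : ℤ) < |(i : ℤ) - (k : ℤ)|
  · rw [hC i k hk, zero_mul]
  · have htri := abs_sub_le (i : ℤ) (k : ℤ) (j : ℤ)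
    rw [hD k j (by omega), mul_zero]

/-- The linear span of products of a band matrix of band width `N` and a band
matrix of band width `N'` is exactly the space of band matrices of band width `N + N'`. -/
theorem stmt17 (p N N' : ℕ) :
    (Submodule.span ℂ {M : Matrix (Fin p) (Fin p) ℂ |
        ∃ C D : Matrix (Fin p) (Fin p) ℂ,
          (∀ i j : Fin p, (N : ℤ) < |(i : ℤ) - (j : ℤ)| → C i j = 0) ∧
          (∀ i j : Fin p, (N' : ℤ) < |(i : ℤ) - (j : ℤ)| → D i j = 0) ∧
          M = C * D} : Set (Matrix (Fin p) (Fin p) ℂ)) =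
      {B : Matrix (Fin p) (Fin p) ℂ |
        ∀ i j : Fin p, ((N : ℤ) + (N' : ℤ)) < |(i : ℤ) - (j : ℤ)| → B i j = 0} := by
  ext B
  simp only [SetLike.mem_coe, Set.mem_ofPred_eq]
  constructor
  · intro hB
    induction hB using Submodule.span_induction with
    | mem M hM =>
      obtain ⟨C, D, hC, hD, rfl⟩ := hM
      exact mul_apply_eq_zero_of_add_lt_abs_sub hC hD
    | zero => exact fun _ _ _ => rfl
    | add X Y _ _ hX hY =>
      intro i j hij
      rw [Matrix.add_apply, hX i j hij, hY i j hij, add_zero]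
    | smul c X _ hX =>
      intro i j hij
      rw [Matrix.smul_apply, hX i j hij, smul_zero]
  · intro hB
    rw [Matrix.matrix_eq_sum_single B]
    refine Submodule.sum_mem _ fun i _ => Submodule.sum_mem _ fun j _ => ?_
    by_cases hij : (N : ℤ) + (N' : ℤ) < |(i : ℤ) - (j : ℤ)|
    · rw [hB i j hij, Matrix.single_zero]
      exact Submodule.zero_mem _
    · obtain ⟨k, hik, hkj⟩ := exists_index_between i j (not_lt.mp hij)
      refine Submodule.subset_span ⟨Matrix.single i k (B i j), Matrix.single k j 1,
        single_apply_eq_zero_of_lt_abs_sub _ hik, single_apply_eq_zero_of_lt_abs_sub _ hkj, ?_⟩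
      rw [Matrix.single_mul_single_same, mul_one]
end

section
/- Let (X,d) be a second-countable metric space equipped with its Borel σ-algebra and a measure μ, and fix ε > 0. For measurable sets U, V ⊆ X of finite μ-measure, let θ_{U,V} be the rank-one continuous linear operator on the Hilbert space L²(X,μ;ℂ) given by ξ ↦ ⟨1_V, ξ⟩ · 1_U, where 1_U, 1_V ∈ L²(X,μ;ℂ) are the indicator functions of U and V. Then the closure of the ℂ-linear span of { θ_{U,V} : U, V measurable, μ(U) < ∞, μ(V) < ∞, diam(U) < ε, diam(V) < ε } equals the set of compact operators on L²(X,μ;ℂ). -/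
open MeasureTheory

section RankOne

open InnerProductSpace

variable {𝕜 H : Type*} [RCLike 𝕜] [NormedAddCommGroup H] [InnerProductSpace 𝕜 H]

theorem isCompactOperator_rankOne (x y : H) : IsCompactOperator (rankOne 𝕜 x y) := by
  rw [rankOne_def']
  exact (isCompactOperator_of_locallyCompactSpace_rng
    (ContinuousLinearMap.toSpanSingleton 𝕜 x)).comp_clm (innerSL 𝕜 y)

/-- A closed subspace of operators that contains `rankOne 𝕜 x y` for all `x`, `y` in a set with
dense span contains every rank-one operator. -/
theorem rankOne_mem_of_dense_span {S : Set H} (hS : (Submodule.span 𝕜 S).topologicalClosure = ⊤)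
    {M : Submodule 𝕜 (H →L[𝕜] H)} (hM : IsClosed (M : Set (H →L[𝕜] H)))
    (h : ∀ x ∈ S, ∀ y ∈ S, rankOne 𝕜 x y ∈ M) (x y : H) : rankOne 𝕜 x y ∈ M := by
  have hdense : ∀ z : H, z ∈ closure (Submodule.span 𝕜 S : Set H) := fun z => by
    have hz : z ∈ (Submodule.span 𝕜 S).topologicalClosure := hS ▸ Submodule.mem_top
    exact hz
  have hleft : ∀ y ∈ S, ∀ x, rankOne 𝕜 x y ∈ M := fun y hy x => by
    have hcl : IsClosed {x : H | rankOne 𝕜 x y ∈ M} :=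
      hM.preimage (show Continuous fun x : H => rankOne 𝕜 x y by fun_prop)
    refine closure_minimal (fun z hz => ?_) hcl (hdense x)
    induction hz using Submodule.span_induction with
    | mem z hz => exact h z hz y hy
    | zero => simp
    | add a b _ _ ha hb => simpa using M.add_mem ha hb
    | smul c a _ ha => simpa using M.smul_mem c ha
  have hcl : IsClosed {y : H | rankOne 𝕜 x y ∈ M} :=
    hM.preimage (rankOne 𝕜 x).continuous
  refine closure_minimal (fun z hz => ?_) hcl (hdense y)
  induction hz using Submodule.span_induction with
  | mem z hz => exact hleft z hz x
  | zero => simp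
  | add a b _ _ ha hb => simpa using M.add_mem ha hb
  | smul c a _ ha => simpa using M.smul_mem (starRingEnd 𝕜 c) ha

/-- A compact operator on an inner product space is approximated in norm by its compositions with
orthogonal projections onto finite-dimensional subspaces. -/
theorem IsCompactOperator.exists_norm_sub_starProjection_comp_le {T : H →L[𝕜] H}
    (hT : IsCompactOperator T) {δ : ℝ} (hδ : 0 < δ) :
    ∃ (K : Submodule 𝕜 H) (_ : FiniteDimensional 𝕜 K), ‖T - K.starProjection ∘L T‖ ≤ δ := by
  have htb : TotallyBounded (closure (T '' Metric.closedBall 0 1)) :=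
    (IsCompactOperator.isCompact_closure_image_closedBall (f := (T : H →ₗ[𝕜] H))
      hT 1).totallyBounded
  obtain ⟨t, ht, hcover⟩ := Metric.totallyBounded_iff.1 htb δ hδ
  have hfin : FiniteDimensional 𝕜 (Submodule.span 𝕜 t) := FiniteDimensional.span_of_finite 𝕜 ht
  refine ⟨Submodule.span 𝕜 t, hfin, ?_⟩
  refine ContinuousLinearMap.opNorm_le_of_unit_norm hδ.le fun x hx => ?_
  have hTx : T x ∈ closure (T '' Metric.closedBall 0 1) :=
    subset_closure ⟨x, by simp [hx], rfl⟩
  obtain ⟨y, hy, hxy⟩ := Set.mem_iUnion₂.1 (hcover hTx)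
  have hmin := (Submodule.span 𝕜 t).starProjection_minimal (T x)
  simp only [sub_apply, ContinuousLinearMap.comp_apply]
  rw [hmin]
  refine (ciInf_le ⟨0, Set.forall_mem_range.2 fun _ => norm_nonneg _⟩
    (⟨y, Submodule.subset_span hy⟩ : Submodule.span 𝕜 t)).trans ?_
  rw [← dist_eq_norm]
  exact (Metric.mem_ball.1 hxy).le

/-- If `S` has dense span, the rank-one operators built from `S` span a dense subspace of the
compact operators. -/
theorem closure_span_rankOne_eq_setOf_isCompactOperator [CompleteSpace H] {S : Set H}
    (hS : (Submodule.span 𝕜 S).topologicalClosure = ⊤) :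
    closure (Submodule.span 𝕜 {T : H →L[𝕜] H | ∃ x ∈ S, ∃ y ∈ S, T = rankOne 𝕜 x y} :
      Set (H →L[𝕜] H)) = {T : H →L[𝕜] H | IsCompactOperator T} := by
  apply subset_antisymm
  · refine closure_minimal ?_ isClosed_setOfPred_isCompactOperator
    refine (Submodule.span_le (p := compactOperator (RingHom.id 𝕜) H H)).2 ?_
    rintro _ ⟨x, _, y, _, rfl⟩
    exact isCompactOperator_rankOne x y
  · intro T hT
    set M := (Submodule.span 𝕜
      {T : H →L[𝕜] H | ∃ x ∈ S, ∃ y ∈ S, T = rankOne 𝕜 x y}).topologicalClosure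
    have hM : IsClosed (M : Set (H →L[𝕜] H)) := Submodule.isClosed_topologicalClosure _
    have hrank : ∀ x y, rankOne 𝕜 x y ∈ M := rankOne_mem_of_dense_span hS hM
      fun x hx y hy =>
        Submodule.le_topologicalClosure _ (Submodule.subset_span ⟨x, hx, y, hy, rfl⟩)
    change T ∈ (M : Set (H →L[𝕜] H))
    rw [← hM.closure_eq, Metric.mem_closure_iff]
    intro δ hδ
    obtain ⟨K, hK, hKT⟩ :=
      IsCompactOperator.exists_norm_sub_starProjection_comp_le hT (half_pos hδ)
    refine ⟨K.starProjection ∘L T, ?_, ?_⟩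
    · rw [(stdOrthonormalBasis 𝕜 K).starProjection_eq_sum_rankOne,
        ContinuousLinearMap.finsetSum_comp]
      refine M.sum_mem fun i _ => ?_
      rw [rankOne_comp]
      exact hrank _ _
    · rw [dist_eq_norm]
      linarith

end RankOne

section Indicator

open Filter Topology
open scoped ENNReal

variable {X : Type*} [MeasurableSpace X] {μ : Measure X}

/-- If a subspace of `Lᵖ` contains the indicators of all measurable subsets of finite measure of
the members of a countable cover, then its closure contains all indicators. -/
theorem indicatorConstLp_mem_topologicalClosure_of_cover {p : ℝ≥0∞} [Fact (1 ≤ p)] (hp : p ≠ ∞)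
    {B : ℕ → Set X} (hB : ∀ n, MeasurableSet (B n)) (hcover : ⋃ n, B n = Set.univ)
    {N : Submodule ℂ (Lp ℂ p μ)}
    (hN : ∀ n, ∀ s ⊆ B n, ∀ (hs : MeasurableSet s) (hμs : μ s ≠ ∞),
      indicatorConstLp p hs hμs (1 : ℂ) ∈ N)
    {s : Set X} (hs : MeasurableSet s) (hμs : μ s ≠ ∞) :
    indicatorConstLp p hs hμs (1 : ℂ) ∈ N.topologicalClosure := by
  have hA : ∀ n, MeasurableSet (⋃ i < n, B i) := fun n =>
    MeasurableSet.iUnion fun i => MeasurableSet.iUnion fun _ => hB i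
  have hsA : ∀ n, MeasurableSet (s ∩ ⋃ i < n, B i) := fun n => hs.inter (hA n)
  have hμ : ∀ t : Set X, μ (s ∩ t) ≠ ∞ := fun t =>
    measure_ne_top_of_subset Set.inter_subset_left hμs
  have hmem : ∀ n, indicatorConstLp p (hsA n) (hμ _) (1 : ℂ) ∈ N := by
    intro n
    induction n with
    | zero => simp
    | succ n ih =>
      have hsD : MeasurableSet (s ∩ (B n \ ⋃ i < n, B i)) := hs.inter ((hB n).diff (hA n))
      have hdisj : Disjoint (s ∩ ⋃ i < n, B i) (s ∩ (B n \ ⋃ i < n, B i)) :=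
        Set.disjoint_sdiff_right.mono Set.inter_subset_right Set.inter_subset_right
      have hunion : s ∩ ⋃ i < n + 1, B i =
          (s ∩ ⋃ i < n, B i) ∪ (s ∩ (B n \ ⋃ i < n, B i)) := by
        rw [Set.biUnion_lt_succ, ← Set.inter_union_distrib_left, Set.union_sdiff_self]
      have hsum := N.add_mem ih
        (hN n _ (Set.inter_subset_right.trans Set.sdiff_subset) hsD (hμ _))
      rw [← indicatorConstLp_disjoint_union _ _ _ _ hdisj] at hsum
      simpa only [hunion] using hsum
  refine mem_closure_of_tendsto (b := atTop) (tendsto_indicatorConstLp_set (ht := hsA) (hμt := fun _ => hμ _)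
    hp ?_) (Eventually.of_forall hmem)
  have hmono : Monotone fun n => ⋃ i < n, B i := fun m n hmn =>
    Set.biUnion_subset_biUnion_left fun i hi => lt_of_lt_of_le hi hmn
  have hanti : Antitone fun n => s \ ⋃ i < n, B i := fun m n hmn =>
    Set.sdiff_subset_sdiff_right (hmono hmn)
  have hempty : ⋂ n, s \ ⋃ i < n, B i = ∅ := by
    refine Set.eq_empty_of_forall_notMem fun x hx => ?_
    obtain ⟨n, hn⟩ := Set.mem_iUnion.1 (hcover ▸ Set.mem_univ x)
    exact (Set.mem_iInter.1 hx (n + 1)).2 (Set.mem_biUnion (Nat.lt_succ_self n) hn)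
  have hlim := tendsto_measure_iInter_atTop (μ := μ)
    (fun n => (hs.diff (hA n)).nullMeasurableSet) hanti
    ⟨0, measure_ne_top_of_subset Set.sdiff_subset hμs⟩
  rw [hempty, measure_empty] at hlim
  refine hlim.congr fun n => ?_
  rw [symmDiff_of_le Set.inter_subset_left, Set.sdiff_self_inter, Function.comp_apply]

/-- A closed subspace of `Lᵖ` that contains all indicators of measurable sets of finite measure is
the whole space. -/
theorem Submodule.eq_top_of_indicatorConstLp_mem {p : ℝ≥0∞} [Fact (1 ≤ p)] (hp : p ≠ ∞)
    {N : Submodule ℂ (Lp ℂ p μ)} (hN : IsClosed (N : Set (Lp ℂ p μ)))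
    (h : ∀ (s : Set X) (hs : MeasurableSet s) (hμs : μ s ≠ ∞),
      indicatorConstLp p hs hμs (1 : ℂ) ∈ N) : N = ⊤ := by
  refine eq_top_iff.2 fun f _ => ?_
  induction f using Lp.induction hp with
  | @indicatorConst c s hs hμs =>
    rw [Lp.simpleFunc.coe_indicatorConst]
    have hc : indicatorConstLp p hs hμs.ne c = c • indicatorConstLp p hs hμs.ne (1 : ℂ) := by
      rw [indicatorConstLp, indicatorConstLp, ← MemLp.toLp_const_smul]
      congr 1
      ext x
      by_cases hx : x ∈ s <;> simp [hx]
    rw [hc]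
    exact N.smul_mem c (h _ hs hμs.ne)
  | add hf hg _ ihf ihg => exact N.add_mem (ihf trivial) (ihg trivial)
  | isClosed => simpa using hN

end Indicator

/-- In `L²(X, μ)` over a second-countable metric space `X` with Borel measure
`μ`, the closed linear span of the rank-one operators `ξ ↦ ⟨1_V, ξ⟩ • 1_U`, for measurable
sets `U, V` of finite measure and diameter `< ε`, is the set of compact operators. -/
theorem stmt19 {X : Type*} [MetricSpace X] [SecondCountableTopology X]
    [MeasurableSpace X] [BorelSpace X] (μ : Measure X) (ε : ℝ) (hε : 0 < ε) :
    closure ((Submodule.span ℂ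
      {T : Lp ℂ 2 μ →L[ℂ] Lp ℂ 2 μ |
        ∃ (U V : Set X) (hU : MeasurableSet U) (hV : MeasurableSet V)
          (hμU : μ U ≠ ⊤) (hμV : μ V ≠ ⊤),
          Metric.diam U < ε ∧ Metric.diam V < ε ∧
          T = (innerSL ℂ (indicatorConstLp 2 hV hμV (1 : ℂ))).smulRight
                (indicatorConstLp 2 hU hμU (1 : ℂ))} :
        Submodule ℂ (Lp ℂ 2 μ →L[ℂ] Lp ℂ 2 μ)) : Set (Lp ℂ 2 μ →L[ℂ] Lp ℂ 2 μ)) =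
      {T : Lp ℂ 2 μ →L[ℂ] Lp ℂ 2 μ | IsCompactOperator T} := by
  set S : Set (Lp ℂ 2 μ) := {f | ∃ (U : Set X) (hU : MeasurableSet U) (hμU : μ U ≠ ⊤),
    Metric.diam U < ε ∧ f = indicatorConstLp 2 hU hμU (1 : ℂ)}
  have hS : (Submodule.span ℂ S).topologicalClosure = ⊤ := by
    obtain ⟨B, hB, hbdd, hdiam, hcover, -⟩ :=
      SeparableSpace.exists_measurable_partition_diam_le X (half_pos hε)
    refine Submodule.eq_top_of_indicatorConstLp_mem (by simp)
      (Submodule.isClosed_topologicalClosure _) fun s hs hμs => ?_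
    refine indicatorConstLp_mem_topologicalClosure_of_cover (by simp) hB hcover ?_ hs hμs
    refine fun n t htB ht hμt => Submodule.subset_span ⟨t, ht, hμt, ?_, rfl⟩
    linarith [Metric.diam_mono htB (hbdd n), hdiam n]
  rw [← closure_span_rankOne_eq_setOf_isCompactOperator hS]
  congr 3
  ext T
  constructor
  · rintro ⟨U, V, hU, hV, hμU, hμV, hdU, hdV, rfl⟩
    exact ⟨_, ⟨U, hU, hμU, hdU, rfl⟩, _, ⟨V, hV, hμV, hdV, rfl⟩, rfl⟩
  · rintro ⟨_, ⟨U, hU, hμU, hdU, rfl⟩, _, ⟨V, hV, hμV, hdV, rfl⟩, rfl⟩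
    exact ⟨U, V, hU, hV, hμU, hμV, hdU, hdV, rfl⟩
end
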